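/- Let F = (X_n, K_n, π_n)_{n≥1} be a family of irreducible birth and death chains on X_n = {0,1,...,n} and F_c the family of associated continuous-time chains. If F_c^L and F_c^R have total variation cutoffs with cutoff times r_n and s_n respectively, then F_c has a maximum total variation cutoff with cutoff time t_n = max{r_n, s_n}. The same statement holds for the discrete-time families F^L, F^R and F under the assumption inf_{n,i} K_n(i,i) > 0. -/

import Mathlib

open scoped BigOperators
open Filter Matrix Polynomial MeasureTheory

noncomputable section

/-- An irreducible birth and death chain on `{0,1,...,n}`, together with its
(unique) stationary distribution. -/
structure BDChain (n : ℕ) where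
  K : Matrix (Fin (n + 1)) (Fin (n + 1)) ℝ
  pi : Fin (n + 1) → ℝ
  K_nonneg : ∀ i j, 0 ≤ K i j
  K_rowSum : ∀ i, ∑ j, K i j = 1
  K_tridiag : ∀ i j : Fin (n + 1), 1 < |(i : ℤ) - (j : ℤ)| → K i j = 0
  K_irred : ∀ i : ℕ, ∀ h : i < n,
    0 < K ⟨i, by omega⟩ ⟨i + 1, by omega⟩ ∧ 0 < K ⟨i + 1, by omega⟩ ⟨i, by omega⟩
  pi_pos : ∀ i, 0 < pi i
  pi_sum : ∑ i, pi i = 1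
  pi_stat : ∀ j, ∑ i, pi i * K i j = pi j

namespace BDChain

variable {n : ℕ}

/-- `π([0,M])` -/
def piLow (c : BDChain n) (M : Fin (n + 1)) : ℝ :=
  ∑ ℓ : Fin (n + 1), if ℓ ≤ M then c.pi ℓ else 0

/-- `π([M,n])` -/
def piHigh (c : BDChain n) (M : Fin (n + 1)) : ℝ :=
  ∑ ℓ : Fin (n + 1), if M ≤ ℓ then c.pi ℓ else 0

/-- `π([a,b])` -/
def piInt (c : BDChain n) (a b : Fin (n + 1)) : ℝ :=
  ∑ ℓ : Fin (n + 1), if a ≤ ℓ ∧ ℓ ≤ b then c.pi ℓ else 0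

/-- The substochastic matrix of the chain killed at state `i`. -/
def killed (c : BDChain n) (i : Fin (n + 1)) : Matrix (Fin (n + 1)) (Fin (n + 1)) ℝ :=
  Matrix.of fun x y => if x = i ∨ y = i then 0 else c.K x y

/-- `P_j(τ_i > m)`, where `τ_i` is the discrete-time hitting time of state `i`. -/
def hitSurv (c : BDChain n) (i j : Fin (n + 1)) (m : ℕ) : ℝ :=
  if j = i then 0 else ∑ y, (c.killed i ^ m) j y

/-- `P_j(τ̃_i > t)`, where `τ̃_i` is the continuous-time hitting time of state `i`. -/
def hitSurvC (c : BDChain n) (i j : Fin (n + 1)) (t : ℝ) : ℝ :=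
  ∑' m : ℕ, (Real.exp (-t) * t ^ m / m.factorial) * c.hitSurv i j m

/-- `E_j τ_i` -/
def hitMean (c : BDChain n) (i j : Fin (n + 1)) : ℝ :=
  ∑' m : ℕ, c.hitSurv i j m

/-- `Var_j τ_i` -/
def hitVar (c : BDChain n) (i j : Fin (n + 1)) : ℝ :=
  (∑' m : ℕ, (2 * (m : ℝ) + 1) * c.hitSurv i j m) - (c.hitMean i j) ^ 2

/-- `E_j τ̃_i` -/
def hitMeanC (c : BDChain n) (i j : Fin (n + 1)) : ℝ :=
  ∫ t in Set.Ioi (0 : ℝ), c.hitSurvC i j t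

/-- `Var_j τ̃_i` -/
def hitVarC (c : BDChain n) (i j : Fin (n + 1)) : ℝ :=
  (∫ t in Set.Ioi (0 : ℝ), 2 * t * c.hitSurvC i j t) - (c.hitMeanC i j) ^ 2

/-- The substochastic matrix of the chain killed at states `i` and `k`. -/
def killed2 (c : BDChain n) (i k : Fin (n + 1)) : Matrix (Fin (n + 1)) (Fin (n + 1)) ℝ :=
  Matrix.of fun x y => if x = i ∨ x = k ∨ y = i ∨ y = k then 0 else c.K x y

/-- `P_j(min{τ_i, τ_k} > m)` -/
def hitSurv2 (c : BDChain n) (i k j : Fin (n + 1)) (m : ℕ) : ℝ :=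
  if j = i ∨ j = k then 0 else ∑ y, (c.killed2 i k ^ m) j y

/-- `E_j min{τ_i, τ_k}` -/
def hitMean2 (c : BDChain n) (i k j : Fin (n + 1)) : ℝ :=
  ∑' m : ℕ, c.hitSurv2 i k j m

/-- `E_j min{τ̃_i, τ̃_k}` -/
def hitMean2C (c : BDChain n) (i k j : Fin (n + 1)) : ℝ :=
  ∫ t in Set.Ioi (0 : ℝ),
    ∑' m : ℕ, (Real.exp (-t) * t ^ m / m.factorial) * c.hitSurv2 i k j m

/-- The continuous-time kernel `H_t(x,y) = e^{-t(I-K)}(x,y)`. -/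
def Ht (c : BDChain n) (t : ℝ) (x y : Fin (n + 1)) : ℝ :=
  ∑' m : ℕ, (Real.exp (-t) * t ^ m / m.factorial) * (c.K ^ m) x y

/-- Discrete-time total variation distance from starting state `x` at time `m`. -/
def dTV (c : BDChain n) (x : Fin (n + 1)) (m : ℕ) : ℝ :=
  ⨆ A : Finset (Fin (n + 1)), (∑ y ∈ A, (c.K ^ m) x y - ∑ y ∈ A, c.pi y)

/-- Continuous-time total variation distance from starting state `x` at time `t`. -/
def dTVC (c : BDChain n) (x : Fin (n + 1)) (t : ℝ) : ℝ :=
  ⨆ A : Finset (Fin (n + 1)), (∑ y ∈ A, c.Ht t x y - ∑ y ∈ A, c.pi y)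

/-- Maximum (over starting states) discrete-time total variation distance. -/
def dTVMax (c : BDChain n) (m : ℕ) : ℝ := ⨆ x, c.dTV x m

/-- Maximum (over starting states) continuous-time total variation distance. -/
def dTVMaxC (c : BDChain n) (t : ℝ) : ℝ := ⨆ x, c.dTVC x t

/-- Discrete-time separation from starting state `x` at time `m`. -/
def sep (c : BDChain n) (x : Fin (n + 1)) (m : ℕ) : ℝ :=
  ⨆ y, (1 - (c.K ^ m) x y / c.pi y)

/-- Continuous-time separation from starting state `x` at time `t`. -/
def sepC (c : BDChain n) (x : Fin (n + 1)) (t : ℝ) : ℝ :=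
  ⨆ y, (1 - c.Ht t x y / c.pi y)

end BDChain

/-- Discrete-time `ε`-mixing time for a distance profile `d`. -/
def mixD (d : ℕ → ℝ) (ε : ℝ) : ℕ := sInf {m : ℕ | d m ≤ ε}

/-- Continuous-time `ε`-mixing time for a distance profile `d`. -/
def mixC (d : ℝ → ℝ) (ε : ℝ) : ℝ := sInf {t : ℝ | 0 ≤ t ∧ d t ≤ ε}

/-- The set of (real) eigenvalues of a square matrix. -/
def eigSet {ι : Type*} [Fintype ι] (M : Matrix ι ι ℝ) : Set ℝ :=
  {x | ∃ v : ι → ℝ, v ≠ 0 ∧ M.mulVec v = x • v}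

/-- `l` is the smallest non-zero eigenvalue of `M`. -/
def IsSmallestNonzeroEig {ι : Type*} [Fintype ι] (M : Matrix ι ι ℝ) (l : ℝ) : Prop :=
  l ∈ eigSet M ∧ l ≠ 0 ∧ ∀ x ∈ eigSet M, x ≠ 0 → l ≤ x

/-- `l` is the smallest eigenvalue of `M`. -/
def IsSmallestEig {ι : Type*} [Fintype ι] (M : Matrix ι ι ℝ) (l : ℝ) : Prop :=
  l ∈ eigSet M ∧ ∀ x ∈ eigSet M, l ≤ x

/-- The principal submatrix of `I - K` indexed by the states `0, 1, ..., M-1`. -/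
def BDChain.subIK {n : ℕ} (c : BDChain n) (M : Fin (n + 1)) :
    Matrix (Fin (M : ℕ)) (Fin (M : ℕ)) ℝ :=
  Matrix.of fun a b =>
    (1 - c.K) (Fin.castLE M.isLt.le a) (Fin.castLE M.isLt.le b)

/-- A family of chains, with `ε ↦ n ↦ T ε n` the mixing time profile, presents a cutoff
with cutoff time `t`. -/
def cutoffWith (T : ℝ → ℕ → ℝ) (t : ℕ → ℝ) : Prop :=
  ∀ ε ∈ Set.Ioo (0 : ℝ) 1, Filter.Tendsto (fun n => T ε n / t n) Filter.atTop (nhds 1)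

/-- A family of chains presents a cutoff. -/
def hasCutoff (T : ℝ → ℕ → ℝ) : Prop :=
  ∃ t : ℕ → ℝ, (∀ n, 0 < t n) ∧ cutoffWith T t

/-- A family of chains presents a `(t_n, b_n)` cutoff. -/
def cutoffWindow (T : ℝ → ℕ → ℝ) (t b : ℕ → ℝ) : Prop :=
  (∀ᶠ n in Filter.atTop, 0 < t n) ∧ (∀ᶠ n in Filter.atTop, 0 < b n) ∧
  Filter.Tendsto (fun n => b n / t n) Filter.atTop (nhds 0) ∧
  ∀ ε ∈ Set.Ioo (0 : ℝ) 1, ∃ C : ℝ, ∀ᶠ n in Filter.atTop, |T ε n - t n| ≤ C * b n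

/-- The total variation distance between two weight functions on a finite type. -/
def tvDist {ι : Type*} (μ ν : ι → ℝ) : ℝ :=
  ⨆ A : Finset ι, (∑ y ∈ A, μ y - ∑ y ∈ A, ν y)

lemma tvDist_le {ι : Type*} {μ ν : ι → ℝ} {b : ℝ}
    (h : ∀ A : Finset ι, ∑ y ∈ A, μ y - ∑ y ∈ A, ν y ≤ b) : tvDist μ ν ≤ b :=
  ciSup_le h

section TotalVariation

variable {ι : Type*} [Fintype ι]

lemma sum_sub_sum_le_tvDist (μ ν : ι → ℝ) (A : Finset ι) :
    ∑ y ∈ A, μ y - ∑ y ∈ A, ν y ≤ tvDist μ ν :=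
  le_ciSup (f := fun A : Finset ι => ∑ y ∈ A, μ y - ∑ y ∈ A, ν y)
    (Set.finite_range _).bddAbove A

lemma tvDist_nonneg (μ ν : ι → ℝ) : 0 ≤ tvDist μ ν := by
  simpa using sum_sub_sum_le_tvDist μ ν ∅

/-- Integrating a function with values in `[a, a + w]` against the difference of two weight
functions of equal total mass gives at most `w` times their total variation distance. -/
lemma sum_sub_mul_le_mul_tvDist {μ ν : ι → ℝ} (hmass : ∑ x, μ x = ∑ x, ν x)
    {f : ι → ℝ} {a w : ℝ} (hf : ∀ x, a ≤ f x) (hf' : ∀ x, f x ≤ a + w) :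
    ∑ x, μ x * f x - ∑ x, ν x * f x ≤ w * tvDist μ ν := by
  classical
  rcases isEmpty_or_nonempty ι with hι | ⟨⟨x₀⟩⟩
  · simp [tvDist, Finset.eq_empty_of_isEmpty]
  have hw : 0 ≤ w := by linarith [hf x₀, hf' x₀]
  have h1 : ∑ x, μ x * f x - ∑ x, ν x * f x = ∑ x, (μ x - ν x) * (f x - a) := by
    have : ∑ x, (μ x - ν x) * (f x - a)
        = (∑ x, μ x * f x - ∑ x, ν x * f x) - a * (∑ x, μ x - ∑ x, ν x) := by
      rw [← Finset.sum_sub_distrib, ← Finset.sum_sub_distrib, Finset.mul_sum,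
        ← Finset.sum_sub_distrib]
      exact Finset.sum_congr rfl fun x _ => by ring
    rw [this, hmass]; ring
  rw [h1]
  calc ∑ x, (μ x - ν x) * (f x - a)
      ≤ ∑ x, (if ν x ≤ μ x then w * (μ x - ν x) else 0) := by
        refine Finset.sum_le_sum fun x _ => ?_
        split_ifs with h
        · nlinarith [hf x, hf' x]
        · nlinarith [hf x, hf' x]
    _ = w * (∑ x ∈ Finset.univ.filter (fun x => ν x ≤ μ x), μ x
          - ∑ x ∈ Finset.univ.filter (fun x => ν x ≤ μ x), ν x) := by
        rw [← Finset.sum_filter, ← Finset.mul_sum, Finset.sum_sub_distrib]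
    _ ≤ w * tvDist μ ν := mul_le_mul_of_nonneg_left (sum_sub_sum_le_tvDist _ _ _) hw

lemma sum_finset_eq_sum_mul_indicator [DecidableEq ι] (μ : ι → ℝ) (A : Finset ι) :
    ∑ y ∈ A, μ y = ∑ y, μ y * (if y ∈ A then 1 else 0) := by
  simp

end TotalVariation

/-- A real square matrix with non-negative entries and unit row sums. -/
structure IsStochastic {ι : Type*} [Fintype ι] (A : Matrix ι ι ℝ) : Prop where
  nonneg : ∀ x y, 0 ≤ A x y
  rowSum : ∀ x, ∑ y, A x y = 1

namespace IsStochastic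

variable {ι : Type*} [Fintype ι] {A B : Matrix ι ι ℝ}

lemma one [DecidableEq ι] : IsStochastic (1 : Matrix ι ι ℝ) where
  nonneg x y := by rw [Matrix.one_apply]; split_ifs <;> norm_num
  rowSum x := by simp [Matrix.one_apply]

lemma mul (hA : IsStochastic A) (hB : IsStochastic B) : IsStochastic (A * B) where
  nonneg x y := Finset.sum_nonneg fun z _ => mul_nonneg (hA.nonneg x z) (hB.nonneg z y)
  rowSum x := by
    simp only [Matrix.mul_apply]
    rw [Finset.sum_comm]
    simp [← Finset.mul_sum, hB.rowSum, hA.rowSum]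

lemma pow [DecidableEq ι] (hA : IsStochastic A) (m : ℕ) : IsStochastic (A ^ m) := by
  induction m with
  | zero => simpa using one
  | succ m ih => rw [pow_succ]; exact ih.mul hA

lemma sum_nonneg (hA : IsStochastic A) (x : ι) (S : Finset ι) : 0 ≤ ∑ y ∈ S, A x y :=
  Finset.sum_nonneg fun y _ => hA.nonneg x y

lemma sum_le_one (hA : IsStochastic A) (x : ι) (S : Finset ι) : ∑ y ∈ S, A x y ≤ 1 := by
  rw [← hA.rowSum x]
  exact Finset.sum_le_sum_of_subset_of_nonneg (Finset.subset_univ S) fun y _ _ => hA.nonneg x y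

lemma le_one (hA : IsStochastic A) (x y : ι) : A x y ≤ 1 := by
  simpa using hA.sum_le_one x {y}

lemma tvDist_mul_le (hA : IsStochastic A) (hB : IsStochastic B) {π : ι → ℝ}
    (hπ1 : ∑ x, π x = 1) (hπ : ∀ y, ∑ x, π x * B x y = π y) (x : ι) :
    tvDist ((A * B) x) π ≤ tvDist (A x) π := by
  refine tvDist_le fun S => ?_
  have h := sum_sub_mul_le_mul_tvDist (μ := A x) (ν := π) (by rw [hA.rowSum, hπ1])
    (f := fun z => ∑ y ∈ S, B z y) (a := 0) (w := 1) (fun z => hB.sum_nonneg z S)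
    (fun z => by simpa using hB.sum_le_one z S)
  rw [one_mul] at h
  convert h using 2
  · simp only [Matrix.mul_apply, Finset.mul_sum]
    rw [Finset.sum_comm]
  · simp only [Finset.mul_sum]
    rw [Finset.sum_comm]
    exact Finset.sum_congr rfl fun y _ => (hπ y).symm

end IsStochastic

/-- All `2 × 2` minors of the matrix are non-negative. -/
def IsTP2 {ι : Type*} [LinearOrder ι] (A : Matrix ι ι ℝ) : Prop :=
  ∀ ⦃x y x' y' : ι⦄, x < y → x' < y' → A x y' * A y x' ≤ A x x' * A y y'

/-- The sign of the comparison of `b` with `a`. -/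
def cmpSign {ι : Type*} [LinearOrder ι] (a b : ι) : ℝ :=
  if a < b then 1 else if b < a then -1 else 0

section CmpSign

variable {ι : Type*} [LinearOrder ι]

lemma cmpSign_swap (a b : ι) : cmpSign b a = -cmpSign a b := by
  unfold cmpSign
  rcases lt_trichotomy a b with h | rfl | h
  · simp [h, h.not_gt]
  · simp
  · simp [h, h.not_gt]

lemma abs_cmpSign_le_one (a b : ι) : |cmpSign a b| ≤ 1 := by
  unfold cmpSign; split_ifs <;> norm_num

lemma cmpSign_antitone_left (b : ι) : Antitone fun a => cmpSign a b := by
  intro a a' h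
  simp only [cmpSign]
  split_ifs <;> first | (exfalso; order) | norm_num

end CmpSign

namespace IsTP2

variable {ι : Type*} [LinearOrder ι] {A B : Matrix ι ι ℝ}

lemma one : IsTP2 (1 : Matrix ι ι ℝ) := by
  intro x y x' y' h h'
  have : ¬ (x = y' ∧ y = x') := by rintro ⟨rfl, rfl⟩; exact lt_asymm h h'
  simp only [Matrix.one_apply]
  split_ifs <;> simp_all

lemma mul [Fintype ι] (hA : IsTP2 A) (hB : IsTP2 B) : IsTP2 (A * B) := by
  intro x y x' y' h h'
  have key : (A * B) x x' * (A * B) y y' - (A * B) x y' * (A * B) y x'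
      = ∑ a, ∑ b, A x a * A y b * (B a x' * B b y' - B a y' * B b x') := by
    simp only [Matrix.mul_apply, Finset.sum_mul_sum]
    rw [← Finset.sum_sub_distrib]
    refine Finset.sum_congr rfl fun a _ => ?_
    rw [← Finset.sum_sub_distrib]
    exact Finset.sum_congr rfl fun b _ => by ring
  have swap : ∑ a, ∑ b, A x a * A y b * (B a x' * B b y' - B a y' * B b x')
      = ∑ a, ∑ b, A x b * A y a * (B b x' * B a y' - B b y' * B a x') := Finset.sum_comm
  have pos : 0 ≤ ∑ a, ∑ b, (A x a * A y b - A x b * A y a)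
      * (B a x' * B b y' - B a y' * B b x') := by
    refine Finset.sum_nonneg fun a _ => Finset.sum_nonneg fun b _ => ?_
    rcases lt_trichotomy a b with hab | rfl | hab
    · exact mul_nonneg (sub_nonneg.2 (hA h hab)) (sub_nonneg.2 (by linarith [hB hab h']))
    · simp
    · refine mul_nonneg_of_nonpos_of_nonpos (sub_nonpos.2 (hA h hab)) (sub_nonpos.2 ?_)
      linarith [hB hab h']
  have dbl : ∑ a, ∑ b, (A x a * A y b - A x b * A y a) * (B a x' * B b y' - B a y' * B b x')
      = ∑ a, ∑ b, A x a * A y b * (B a x' * B b y' - B a y' * B b x')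
        + ∑ a, ∑ b, A x b * A y a * (B b x' * B a y' - B b y' * B a x') := by
    simp only [← Finset.sum_add_distrib]
    exact Finset.sum_congr rfl fun a _ => Finset.sum_congr rfl fun b _ => by ring
  linarith

lemma pow [Fintype ι] (hA : IsTP2 A) (m : ℕ) : IsTP2 (A ^ m) := by
  induction m with
  | zero => simpa using one
  | succ m ih => rw [pow_succ]; exact ih.mul hA

lemma minor_mul_cmpSign_nonneg (hA : IsTP2 A) {x y : ι} (h : x ≤ y) (a b : ι) :
    0 ≤ (A x a * A y b - A x b * A y a) * cmpSign a b := by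
  rcases h.eq_or_lt with rfl | h
  · exact le_of_eq (by ring)
  · rcases lt_trichotomy a b with hab | rfl | hab
    · simpa [cmpSign, hab] using hA h hab
    · simp
    · simp only [cmpSign, hab, hab.not_gt, if_true, if_false]
      linarith [hA h hab]

end IsTP2

lemma IsStochastic.sum_mul_sub_sum_mul {ι : Type*} [Fintype ι] {A : Matrix ι ι ℝ}
    (hA : IsStochastic A) (x y : ι) (f : ι → ℝ) :
    2 * (∑ a, A x a * f a - ∑ b, A y b * f b)
      = ∑ a, ∑ b, (A x a * A y b - A x b * A y a) * (f a - f b) := by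
  have e1 : ∑ a, ∑ b, A x a * A y b * f a = ∑ a, A x a * f a := by
    refine Finset.sum_congr rfl fun a _ => ?_
    rw [← Finset.sum_mul, ← Finset.mul_sum, hA.rowSum, mul_one]
  have e2 : ∑ a, ∑ b, A x a * A y b * f b = ∑ b, A y b * f b := by
    rw [Finset.sum_comm]
    refine Finset.sum_congr rfl fun b _ => ?_
    rw [← Finset.sum_mul, ← Finset.sum_mul, hA.rowSum, one_mul]
  have e3 : ∑ a, ∑ b, A x b * A y a * f a = ∑ b, A y b * f b := by rw [Finset.sum_comm, e2]
  have e4 : ∑ a, ∑ b, A x b * A y a * f b = ∑ a, A x a * f a := by rw [Finset.sum_comm, e1]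
  have : ∑ a, ∑ b, (A x a * A y b - A x b * A y a) * (f a - f b)
      = ∑ a, ∑ b, A x a * A y b * f a - ∑ a, ∑ b, A x a * A y b * f b
        - ∑ a, ∑ b, A x b * A y a * f a + ∑ a, ∑ b, A x b * A y a * f b := by
    simp only [← Finset.sum_sub_distrib, ← Finset.sum_add_distrib]
    exact Finset.sum_congr rfl fun a _ => Finset.sum_congr rfl fun b _ => by ring
  rw [this, e1, e2, e3, e4]; ring

section SignOrder

variable {ι : Type*} [LinearOrder ι] [Fintype ι] {A : Matrix ι ι ℝ}

/-- For independent samples `X`, `Y` from rows `x`, `y` of the matrix `A`, this is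
`P(X < Y) - P(X > Y)`. -/
def signMean (A : Matrix ι ι ℝ) (x y : ι) : ℝ :=
  ∑ a, ∑ b, A x a * A y b * cmpSign a b

lemma two_mul_signMean (A : Matrix ι ι ℝ) (x y : ι) :
    2 * signMean A x y = ∑ a, ∑ b, (A x a * A y b - A x b * A y a) * cmpSign a b := by
  have h : signMean A x y = ∑ a, ∑ b, -(A x b * A y a * cmpSign a b) := by
    rw [signMean, Finset.sum_comm]
    refine Finset.sum_congr rfl fun a _ => Finset.sum_congr rfl fun b _ => ?_
    rw [cmpSign_swap a b]; ring
  rw [two_mul]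
  nth_rewrite 2 [h]
  rw [signMean, ← Finset.sum_add_distrib]
  refine Finset.sum_congr rfl fun a _ => ?_
  rw [← Finset.sum_add_distrib]
  exact Finset.sum_congr rfl fun b _ => by ring

lemma signMean_swap (A : Matrix ι ι ℝ) (x y : ι) : signMean A y x = -signMean A x y := by
  simp only [signMean, ← Finset.sum_neg_distrib]
  rw [Finset.sum_comm]
  refine Finset.sum_congr rfl fun a _ => Finset.sum_congr rfl fun b _ => ?_
  rw [cmpSign_swap a b]; ring

lemma IsTP2.signMean_nonneg (hT : IsTP2 A) {x y : ι} (h : x ≤ y) : 0 ≤ signMean A x y := by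
  have := two_mul_signMean A x y
  have : 0 ≤ ∑ a, ∑ b, (A x a * A y b - A x b * A y a) * cmpSign a b :=
    Finset.sum_nonneg fun a _ => Finset.sum_nonneg fun b _ => hT.minor_mul_cmpSign_nonneg h a b
  linarith

/-- Rows of a totally positive stochastic matrix are stochastically ordered. -/
lemma IsTP2.sum_mul_antitone (hT : IsTP2 A) (hA : IsStochastic A) {x y : ι} (h : x ≤ y)
    {f : ι → ℝ} (hf : Antitone f) : ∑ b, A y b * f b ≤ ∑ a, A x a * f a := by
  have key := hA.sum_mul_sub_sum_mul x y f
  have : 0 ≤ ∑ a, ∑ b, (A x a * A y b - A x b * A y a) * (f a - f b) := by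
    refine Finset.sum_nonneg fun a _ => Finset.sum_nonneg fun b _ => ?_
    have hm := hT.minor_mul_cmpSign_nonneg h a b
    rcases lt_trichotomy a b with hab | rfl | hab
    · simp only [cmpSign, hab, if_true, mul_one] at hm
      exact mul_nonneg hm (sub_nonneg.2 (hf hab.le))
    · simp
    · simp only [cmpSign, hab, hab.not_gt, if_true, if_false] at hm
      exact mul_nonneg_of_nonpos_of_nonpos (by linarith) (sub_nonpos.2 (hf hab.le))
  linarith

/-- The difference of two rows of a totally positive stochastic matrix, tested against a function
with oscillation at most one, is controlled by `signMean`. -/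
lemma IsTP2.sum_mul_sub_le_signMean (hT : IsTP2 A) (hA : IsStochastic A) {x y : ι} (h : x ≤ y)
    {f : ι → ℝ} (hf : ∀ a b, f a - f b ≤ 1) :
    ∑ a, A x a * f a - ∑ b, A y b * f b ≤ signMean A x y := by
  have key := hA.sum_mul_sub_sum_mul x y f
  have key2 := two_mul_signMean A x y
  have : ∑ a, ∑ b, (A x a * A y b - A x b * A y a) * (f a - f b)
      ≤ ∑ a, ∑ b, (A x a * A y b - A x b * A y a) * cmpSign a b := by
    refine Finset.sum_le_sum fun a _ => Finset.sum_le_sum fun b _ => ?_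
    have hm := hT.minor_mul_cmpSign_nonneg h a b
    rcases lt_trichotomy a b with hab | rfl | hab
    · simp only [cmpSign, hab, if_true, mul_one] at hm ⊢
      nlinarith [hf a b]
    · simp
    · simp only [cmpSign, hab, hab.not_gt, if_true, if_false] at hm ⊢
      nlinarith [hf b a]
  linarith

lemma IsTP2.signMean_antitone_left (hT : IsTP2 A) (hA : IsStochastic A) (y : ι) :
    Antitone fun x => signMean A x y := by
  intro x x' h
  have hφ : Antitone fun a => ∑ b, A y b * cmpSign a b := fun a a' haa =>
    Finset.sum_le_sum fun b _ =>
      mul_le_mul_of_nonneg_left (cmpSign_antitone_left b haa) (hA.nonneg y b)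
  have := hT.sum_mul_antitone hA h hφ
  simpa only [signMean, Finset.mul_sum, mul_assoc] using this

lemma sum_mul_signMean_le (hA : IsStochastic A) {π : ι → ℝ} (hπ0 : ∀ x, 0 ≤ π x)
    (hπ1 : ∑ x, π x = 1) (hπ : ∀ y, ∑ x, π x * A x y = π y) (z : ι) :
    |∑ y, π y * signMean A z y| ≤ 2 * tvDist (A z) π := by
  set φ : ι → ℝ := fun a => ∑ b, π b * cmpSign a b with hφ
  have e1 : ∑ y, π y * signMean A z y = ∑ a, A z a * φ a := by
    have hφ' : ∀ a, φ a = ∑ b, (∑ y, π y * A y b) * cmpSign a b := fun a => by simp only [hπ, hφ]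
    simp only [signMean, hφ', Finset.mul_sum, Finset.sum_mul]
    rw [Finset.sum_comm]
    refine Finset.sum_congr rfl fun a _ => ?_
    rw [Finset.sum_comm]
    exact Finset.sum_congr rfl fun b _ => Finset.sum_congr rfl fun y _ => by ring
  have e2 : ∑ a, π a * φ a = 0 := by
    have : ∑ a, π a * φ a = -∑ a, π a * φ a := by
      simp only [hφ, Finset.mul_sum, ← Finset.sum_neg_distrib]
      rw [Finset.sum_comm]
      refine Finset.sum_congr rfl fun a _ => Finset.sum_congr rfl fun b _ => ?_
      rw [cmpSign_swap a b]; ring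
    linarith
  have hb : ∀ a, |φ a| ≤ 1 := fun a => by
    refine (Finset.abs_sum_le_sum_abs _ _).trans ?_
    rw [← hπ1]
    refine Finset.sum_le_sum fun b _ => ?_
    rw [abs_mul, abs_of_nonneg (hπ0 b)]
    exact mul_le_of_le_one_right (hπ0 b) (abs_cmpSign_le_one a b)
  have hm : ∑ x, A z x = ∑ x, π x := by rw [hA.rowSum, hπ1]
  rw [e1, abs_le]
  constructor
  · have := sum_sub_mul_le_mul_tvDist hm (f := fun a => -φ a) (a := -1) (w := 2)
      (fun x => by linarith [(abs_le.1 (hb x)).2]) (fun x => by linarith [(abs_le.1 (hb x)).1])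
    simp only [mul_neg, Finset.sum_neg_distrib, e2] at this
    linarith
  · have := sum_sub_mul_le_mul_tvDist hm (f := φ) (a := -1) (w := 2)
      (fun x => by linarith [(abs_le.1 (hb x)).1]) (fun x => by linarith [(abs_le.1 (hb x)).2])
    rw [e2] at this
    linarith

/-- For a totally positive stochastic matrix, the distance to stationarity from any row is
controlled by the distances from the two extreme rows. -/
theorem IsTP2.tvDist_le_extremes (hT : IsTP2 A) (hA : IsStochastic A) {π : ι → ℝ}
    (hπ0 : ∀ x, 0 ≤ π x) (hπ1 : ∑ x, π x = 1) (hπ : ∀ y, ∑ x, π x * A x y = π y)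
    {lo hi : ι} (hlo : ∀ x, lo ≤ x) (hhi : ∀ x, x ≤ hi) (x : ι) :
    tvDist (A x) π ≤ 2 * tvDist (A lo) π + 2 * tvDist (A hi) π := by
  refine tvDist_le fun S => ?_
  set f : ι → ℝ := fun a => if a ∈ S then 1 else 0 with hf
  have hosc : ∀ a b, f a - f b ≤ 1 := fun a b => by simp only [hf]; split_ifs <;> norm_num
  have hosc' : ∀ a b, (-f a) - (-f b) ≤ 1 := fun a b => by linarith [hosc b a]
  have hpi : ∑ a, π a * f a = ∑ y, π y * ∑ b, A y b * f b := by
    have hπf : ∑ a, π a * f a = ∑ a, (∑ y, π y * A y a) * f a := by simp only [hπ]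
    simp only [hπf, Finset.sum_mul, Finset.mul_sum]
    rw [Finset.sum_comm]
    exact Finset.sum_congr rfl fun b _ => Finset.sum_congr rfl fun y _ => by ring
  have hpt : ∀ y, ∑ a, A x a * f a - ∑ b, A y b * f b
      ≤ signMean A lo y - signMean A hi y := fun y => by
    have h1 := hT.signMean_nonneg (hlo y)
    have h2 := hT.signMean_nonneg (hhi y)
    rw [signMean_swap] at h2
    rcases le_total x y with h | h
    · have := hT.sum_mul_sub_le_signMean hA h hosc
      have h3 : signMean A x y ≤ signMean A lo y := hT.signMean_antitone_left hA y (hlo x)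
      linarith
    · have := hT.sum_mul_sub_le_signMean hA h hosc'
      simp only [mul_neg, Finset.sum_neg_distrib] at this
      have h3 : signMean A hi y ≤ signMean A x y := hT.signMean_antitone_left hA y (hhi x)
      rw [signMean_swap] at this
      linarith
  rw [sum_finset_eq_sum_mul_indicator, sum_finset_eq_sum_mul_indicator π, hpi]
  calc ∑ a, A x a * f a - ∑ y, π y * ∑ b, A y b * f b
      = ∑ y, π y * (∑ a, A x a * f a - ∑ b, A y b * f b) := by
        simp only [mul_sub, Finset.sum_sub_distrib, ← Finset.sum_mul, hπ1, one_mul]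
    _ ≤ ∑ y, π y * (signMean A lo y - signMean A hi y) :=
        Finset.sum_le_sum fun y _ => mul_le_mul_of_nonneg_left (hpt y) (hπ0 y)
    _ = ∑ y, π y * signMean A lo y - ∑ y, π y * signMean A hi y := by
        simp only [mul_sub, Finset.sum_sub_distrib]
    _ ≤ _ := by
        linarith [(abs_le.1 (sum_mul_signMean_le hA hπ0 hπ1 hπ lo)).2,
          (abs_le.1 (sum_mul_signMean_le hA hπ0 hπ1 hπ hi)).1]

end SignOrder

/-- The Poisson weight `P(N = j)` for `N` of mean `t`. -/
def poissonWeight (t : ℝ) (j : ℕ) : ℝ := Real.exp (-t) * t ^ j / j.factorial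

lemma poissonWeight_nonneg {t : ℝ} (ht : 0 ≤ t) (j : ℕ) : 0 ≤ poissonWeight t j := by
  unfold poissonWeight; positivity

lemma hasSum_poissonWeight_mul_pow (t z : ℝ) :
    HasSum (fun j => poissonWeight t j * z ^ j) (Real.exp (-(1 - z) * t)) := by
  have h := (NormedSpace.expSeries_div_hasSum_exp (t * z)).mul_left (Real.exp (-t))
  rw [← Real.exp_eq_exp_ℝ, ← Real.exp_add] at h
  convert! h using 1
  · funext j; unfold poissonWeight; rw [mul_pow]; ring
  · congr 1; ring

lemma hasSum_poissonWeight (t : ℝ) : HasSum (poissonWeight t) 1 := by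
  simpa using hasSum_poissonWeight_mul_pow t 1

/-- The semigroup `e^{-t(1-B)}` generated by `B - 1`. -/
def expSemigroup {ι : Type*} [Fintype ι] [DecidableEq ι] (B : Matrix ι ι ℝ) (t : ℝ) :
    Matrix ι ι ℝ :=
  NormedSpace.exp (t • (B - 1))

section ExpSemigroup

variable {ι : Type*} [Fintype ι] [DecidableEq ι] {B : Matrix ι ι ℝ}

lemma expSemigroup_eq_smul (B : Matrix ι ι ℝ) (t : ℝ) :
    expSemigroup B t = Real.exp (-t) • NormedSpace.exp (t • B) := by
  have hc : Commute (t • B) (-t • (1 : Matrix ι ι ℝ)) := (Commute.one_right _).smul_right _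
  have h1 : NormedSpace.exp (-t • (1 : Matrix ι ι ℝ)) = Real.exp (-t) • 1 := by
    rw [← Matrix.diagonal_one, ← Matrix.diagonal_smul, Matrix.exp_diagonal,
      ← Matrix.diagonal_smul]
    congr 1
    funext i
    rw [Pi.coe_exp]
    simp [Real.exp_eq_exp_ℝ]
  rw [expSemigroup, smul_sub, sub_eq_add_neg, ← neg_smul, Matrix.exp_add_of_commute _ _ hc, h1,
    Matrix.mul_smul, Matrix.mul_one]

lemma hasSum_expSemigroup_apply (B : Matrix ι ι ℝ) (t : ℝ) (x y : ι) :
    HasSum (fun j => poissonWeight t j * (B ^ j) x y) (expSemigroup B t x y) := by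
  let _ : NormedRing (Matrix ι ι ℝ) := Matrix.linftyOpNormedRing
  let _ : NormedAlgebra ℝ (Matrix ι ι ℝ) := Matrix.linftyOpNormedAlgebra
  have h : HasSum (fun j : ℕ => ((j.factorial : ℝ)⁻¹) • (t • B) ^ j)
      (NormedSpace.exp (t • B)) := NormedSpace.exp_series_hasSum_exp' (t • B)
  have h2 := ((Pi.hasSum.1 ((Pi.hasSum.1 h) x)) y).mul_left (Real.exp (-t))
  rw [expSemigroup_eq_smul]
  convert! h2 using 1
  funext j
  simp only [_root_.smul_pow, Matrix.smul_apply, smul_eq_mul, poissonWeight]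
  ring

lemma hasSum_expSemigroup_mul (B : Matrix ι ι ℝ) (t : ℝ) (x : ι) (f : ι → ℝ) :
    HasSum (fun j => poissonWeight t j * ∑ y, (B ^ j) x y * f y)
      (∑ y, expSemigroup B t x y * f y) := by
  have h := hasSum_sum (s := Finset.univ)
    fun y _ => (hasSum_expSemigroup_apply B t x y).mul_right (f y)
  convert! h using 1
  funext j
  rw [Finset.mul_sum]
  exact Finset.sum_congr rfl fun y _ => by ring

lemma hasSum_sum_expSemigroup (B : Matrix ι ι ℝ) (t : ℝ) (x : ι) (S : Finset ι) :
    HasSum (fun j => poissonWeight t j * ∑ y ∈ S, (B ^ j) x y)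
      (∑ y ∈ S, expSemigroup B t x y) := by
  simpa only [sum_finset_eq_sum_mul_indicator _ S] using
    hasSum_expSemigroup_mul B t x fun y => if y ∈ S then 1 else 0

lemma expSemigroup_add (B : Matrix ι ι ℝ) (s t : ℝ) :
    expSemigroup B (s + t) = expSemigroup B s * expSemigroup B t := by
  rw [expSemigroup, add_smul, Matrix.exp_add_of_commute _ _
    (((Commute.refl _).smul_left s).smul_right t)]
  rfl

lemma IsStochastic.semigroup (hB : IsStochastic B) {t : ℝ} (ht : 0 ≤ t) :
    IsStochastic (expSemigroup B t) where
  nonneg x y := (hasSum_expSemigroup_apply B t x y).nonneg fun j =>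
    mul_nonneg (poissonWeight_nonneg ht j) ((hB.pow j).nonneg x y)
  rowSum x := by
    refine (hasSum_sum_expSemigroup B t x Finset.univ).unique ?_
    simpa only [(hB.pow _).rowSum, mul_one] using hasSum_poissonWeight t

lemma stationary_pow {π : ι → ℝ} (hπ : ∀ y, ∑ x, π x * B x y = π y) (m : ℕ) (y : ι) :
    ∑ x, π x * (B ^ m) x y = π y := by
  induction m generalizing y with
  | zero => simp [Matrix.one_apply]
  | succ m ih =>
    simp only [pow_succ, Matrix.mul_apply, Finset.mul_sum]
    rw [Finset.sum_comm]
    simp only [← mul_assoc, ← Finset.sum_mul, ih, hπ]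

lemma stationary_expSemigroup {π : ι → ℝ} (hπ : ∀ y, ∑ x, π x * B x y = π y) (t : ℝ) (y : ι) :
    ∑ x, π x * expSemigroup B t x y = π y := by
  have h := hasSum_sum (s := Finset.univ)
    fun x _ => (hasSum_expSemigroup_apply B t x y).mul_left (π x)
  have h2 := (hasSum_poissonWeight t).mul_right (π y)
  rw [one_mul] at h2
  refine h.unique ?_
  convert! h2 using 1
  funext j
  rw [← stationary_pow hπ j y, Finset.mul_sum]
  exact Finset.sum_congr rfl fun x _ => by ring

lemma pow_mulVec_of_eigen {f : ι → ℝ} {b : ℝ} (h : B *ᵥ f = b • f) (m : ℕ) :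
    (B ^ m) *ᵥ f = b ^ m • f := by
  induction m with
  | zero => simp
  | succ m ih => rw [pow_succ, ← Matrix.mulVec_mulVec, h, Matrix.mulVec_smul, ih, smul_smul,
      pow_succ, mul_comm]

lemma expSemigroup_mulVec_of_eigen {f : ι → ℝ} {b : ℝ} (h : B *ᵥ f = b • f) (t : ℝ) :
    expSemigroup B t *ᵥ f = Real.exp (-(1 - b) * t) • f := by
  funext x
  have h1 := hasSum_expSemigroup_mul B t x f
  have h2 := (hasSum_poissonWeight_mul_pow t b).mul_right (f x)
  refine h1.unique ?_
  convert! h2 using 1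
  funext j
  have := congrFun (pow_mulVec_of_eigen h j) x
  simp only [Matrix.mulVec, dotProduct, Pi.smul_apply, smul_eq_mul] at this
  rw [this]; ring

/-- Binomial expansion of a convex combination with the identity. -/
lemma lazy_pow_apply (B : Matrix ι ι ℝ) (p : ℝ) (N : ℕ) (x y : ι) :
    (((1 - p) • (1 : Matrix ι ι ℝ) + p • B) ^ N) x y
      = ∑ j ∈ Finset.range (N + 1), (N.choose j * p ^ j * (1 - p) ^ (N - j)) * (B ^ j) x y := by
  have hc : Commute (p • B) ((1 - p) • (1 : Matrix ι ι ℝ)) := (Commute.one_right _).smul_right _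
  rw [add_comm, hc.add_pow, Matrix.sum_apply]
  refine Finset.sum_congr rfl fun j _ => ?_
  rw [_root_.smul_pow, _root_.smul_pow, one_pow, ← nsmul_eq_mul', Matrix.smul_mul, Matrix.mul_smul,
    Matrix.mul_one]
  simp only [Matrix.smul_apply, smul_eq_mul, nsmul_eq_mul]
  ring

lemma choose_mul_pow_le {t : ℝ} (ht : 0 ≤ t) {N : ℕ} (hN : t ≤ N) (hN0 : 0 < N) (j : ℕ) :
    N.choose j * (t / N) ^ j * (1 - t / N) ^ (N - j) ≤ t ^ j / j.factorial := by
  have hN' : (0 : ℝ) < N := by exact_mod_cast hN0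
  have h1 : t / N ≤ 1 := (div_le_one hN').2 hN
  have h0 : 0 ≤ t / N := by positivity
  have hc : (N.choose j : ℝ) ≤ (N : ℝ) ^ j / j.factorial := Nat.choose_le_pow_div j N
  calc N.choose j * (t / N) ^ j * (1 - t / N) ^ (N - j)
      ≤ (N : ℝ) ^ j / j.factorial * (t / N) ^ j * 1 := by
        gcongr
        exact pow_le_one₀ (by linarith) (by linarith)
    _ = t ^ j / j.factorial := by
        rw [div_pow]; field_simp

/-- The semigroup is the limit of powers of lazy kernels. -/
lemma tendsto_lazy_pow (hB : IsStochastic B) {t : ℝ} (ht : 0 ≤ t) (x y : ι) :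
    Tendsto (fun N : ℕ => (((1 - t / N) • (1 : Matrix ι ι ℝ) + (t / N) • B) ^ N) x y) atTop
      (nhds (expSemigroup B t x y)) := by
  rw [← (hasSum_expSemigroup_apply B t x y).tsum_eq]
  have key : ∀ N : ℕ, (((1 - t / N) • (1 : Matrix ι ι ℝ) + (t / N) • B) ^ N) x y
      = ∑' j, (N.choose j * (t / N) ^ j * (1 - t / N) ^ (N - j)) * (B ^ j) x y := fun N => by
    rw [lazy_pow_apply, tsum_eq_sum]
    intro j hj
    rw [Nat.choose_eq_zero_of_lt (by simpa using hj)]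
    simp
  simp only [key]
  refine tendsto_tsum_of_dominated_convergence (bound := fun j : ℕ => t ^ j / j.factorial)
    (Real.summable_pow_div_factorial t) (fun j => ?_) ?_
  · refine Tendsto.mul_const _ ?_
    refine ProbabilityTheory.tendsto_choose_mul_pow_of_tendsto_mul_atTop j
      (p := fun N : ℕ => t / N) ?_
    refine tendsto_const_nhds.congr' ?_
    filter_upwards [eventually_gt_atTop 0] with N hN
    have : (N : ℝ) ≠ 0 := by positivity
    field_simp
  · filter_upwards [eventually_gt_atTop 0, eventually_ge_atTop ⌈t⌉₊] with N hN hN2 j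
    have hN' : (0 : ℝ) < N := by exact_mod_cast hN
    have htN : t ≤ N := Nat.ceil_le.1 hN2
    have h1 : t / N ≤ 1 := (div_le_one hN').2 htN
    have h0 : 0 ≤ N.choose j * (t / N) ^ j * (1 - t / N) ^ (N - j) := by
      have : 0 ≤ 1 - t / N := by linarith
      positivity
    rw [Real.norm_eq_abs, abs_mul, abs_of_nonneg h0, abs_of_nonneg ((hB.pow j).nonneg x y)]
    exact (mul_le_of_le_one_right h0 ((hB.pow j).le_one x y)).trans
      (choose_mul_pow_le ht htN hN j)

end ExpSemigroup

lemma IsTP2.of_tendsto {ι : Type*} [LinearOrder ι] {A : ℕ → Matrix ι ι ℝ} {B : Matrix ι ι ℝ}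
    (hA : ∀ᶠ N in atTop, IsTP2 (A N))
    (h : ∀ x y, Tendsto (fun N => A N x y) atTop (nhds (B x y))) : IsTP2 B := by
  intro x y x' y' hx hx'
  refine le_of_tendsto_of_tendsto ((h x y').mul (h y x')) ((h x x').mul (h y y')) ?_
  filter_upwards [hA] with N hN using hN hx hx'

namespace BDChain

variable {n : ℕ} (c : BDChain n)

lemma isStochastic : IsStochastic c.K := ⟨c.K_nonneg, c.K_rowSum⟩

lemma Ht_eq_expSemigroup (t : ℝ) : c.Ht t = expSemigroup c.K t := by
  funext x y
  rw [← (hasSum_expSemigroup_apply c.K t x y).tsum_eq]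
  rfl

lemma dTV_eq_tvDist (x : Fin (n + 1)) (m : ℕ) : c.dTV x m = tvDist ((c.K ^ m) x) c.pi := rfl

lemma dTVC_eq_tvDist (x : Fin (n + 1)) (t : ℝ) :
    c.dTVC x t = tvDist (expSemigroup c.K t x) c.pi := by
  rw [← Ht_eq_expSemigroup]; rfl

lemma dTV_antitone (x : Fin (n + 1)) : Antitone (c.dTV x) := by
  intro m m' h
  obtain ⟨k, rfl⟩ := Nat.exists_eq_add_of_le h
  rw [dTV_eq_tvDist, dTV_eq_tvDist, pow_add]
  exact (c.isStochastic.pow m).tvDist_mul_le (c.isStochastic.pow k) c.pi_sum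
    (stationary_pow c.pi_stat k) x

lemma dTVC_antitoneOn (x : Fin (n + 1)) : AntitoneOn (c.dTVC x) (Set.Ici 0) := by
  intro s hs t _ h
  obtain ⟨k, rfl⟩ : ∃ k, t = s + k := ⟨t - s, by ring⟩
  rw [dTVC_eq_tvDist, dTVC_eq_tvDist, expSemigroup_add]
  exact (c.isStochastic.semigroup hs).tvDist_mul_le
    (c.isStochastic.semigroup (by linarith)) c.pi_sum (stationary_expSemigroup c.pi_stat k) x

lemma isTP2_lazy {p : ℝ} (hp0 : 0 ≤ p) (hp : p ≤ 1 / 2) :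
    IsTP2 ((1 - p) • (1 : Matrix (Fin (n + 1)) (Fin (n + 1)) ℝ) + p • c.K) := by
  intro x y x' y' h h'
  set A := (1 - p) • (1 : Matrix (Fin (n + 1)) (Fin (n + 1)) ℝ) + p • c.K with hA
  have hnn : ∀ a b, 0 ≤ A a b := fun a b => by
    simp only [hA, Matrix.add_apply, Matrix.smul_apply, smul_eq_mul, Matrix.one_apply]
    have := mul_nonneg hp0 (c.K_nonneg a b)
    split_ifs <;> linarith
  have htri : ∀ a b : Fin (n + 1), 1 < |(a : ℤ) - (b : ℤ)| → A a b = 0 := fun a b hab => by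
    have hne : a ≠ b := by rintro rfl; simp at hab
    simp [hA, hne, c.K_tridiag a b hab]
  have hoff : ∀ a b, a ≠ b → A a b ≤ 1 / 2 := fun a b hab => by
    simp only [hA, Matrix.add_apply, Matrix.smul_apply, smul_eq_mul, Matrix.one_apply, hab,
      if_false]
    have := mul_le_mul_of_nonneg_left (c.isStochastic.le_one a b) hp0
    linarith
  have hdiag : ∀ a, 1 / 2 ≤ A a a := fun a => by
    simp only [hA, Matrix.add_apply, Matrix.smul_apply, smul_eq_mul, Matrix.one_apply, if_true]
    have := mul_nonneg hp0 (c.K_nonneg a a)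
    linarith
  by_cases h1 : 1 < |(x : ℤ) - (y' : ℤ)|
  · rw [htri _ _ h1, zero_mul]; exact mul_nonneg (hnn _ _) (hnn _ _)
  by_cases h2 : 1 < |(y : ℤ) - (x' : ℤ)|
  · rw [htri _ _ h2, mul_zero]; exact mul_nonneg (hnn _ _) (hnn _ _)
  have hx : x' = x ∧ y' = y := by
    rw [not_lt, abs_le] at h1 h2
    rw [Fin.lt_def] at h h'
    rw [Fin.ext_iff, Fin.ext_iff]
    omega
  rw [hx.1, hx.2]
  exact mul_le_mul ((hoff _ _ h.ne).trans (hdiag x)) ((hoff _ _ h.ne').trans (hdiag y))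
    (hnn _ _) (hnn _ _)

lemma isTP2_expSemigroup {t : ℝ} (ht : 0 ≤ t) : IsTP2 (expSemigroup c.K t) := by
  refine IsTP2.of_tendsto ?_ fun x y => tendsto_lazy_pow c.isStochastic ht x y
  filter_upwards [eventually_gt_atTop 0, eventually_ge_atTop ⌈2 * t⌉₊] with N hN hN2
  have hN' : (0 : ℝ) < N := by exact_mod_cast hN
  refine (c.isTP2_lazy (by positivity) ?_).pow N
  rw [div_le_iff₀ hN']
  linarith [Nat.ceil_le.1 hN2]

/-- In continuous time the distance from any state is controlled by those from the end points. -/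
theorem dTVC_le_extremes {t : ℝ} (ht : 0 ≤ t) (x : Fin (n + 1)) :
    c.dTVC x t ≤ 2 * c.dTVC 0 t + 2 * c.dTVC (Fin.last n) t := by
  simp only [dTVC_eq_tvDist]
  exact (c.isTP2_expSemigroup ht).tvDist_le_extremes (c.isStochastic.semigroup ht)
    (fun x => (c.pi_pos x).le) c.pi_sum (stationary_expSemigroup c.pi_stat t) Fin.zero_le
    Fin.le_last x

end BDChain

section Comparison

variable {ι : Type*} [Fintype ι] [DecidableEq ι]

/-- Chernoff bound: the continuous-time kernel at time `t` is, up to the event that fewer than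
`m` steps have been made, closer to stationarity than the `m`-th power. -/
lemma IsStochastic.tvDist_expSemigroup_le {B : Matrix ι ι ℝ} (hB : IsStochastic B) {π : ι → ℝ}
    (hπ0 : ∀ x, 0 ≤ π x) (hπ1 : ∑ x, π x = 1) (hπ : ∀ y, ∑ x, π x * B x y = π y)
    {t z : ℝ} (ht : 0 ≤ t) (hz0 : 0 < z) (hz1 : z ≤ 1) (x : ι) (m : ℕ) :
    tvDist (expSemigroup B t x) π
      ≤ tvDist ((B ^ m) x) π + Real.exp (-(1 - z) * t) / z ^ m := by
  refine tvDist_le fun A => ?_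
  have h1 := (hasSum_sum_expSemigroup B t x A).sub
    ((hasSum_poissonWeight t).mul_right (∑ y ∈ A, π y + tvDist ((B ^ m) x) π))
  have h2 := (hasSum_poissonWeight_mul_pow t z).div_const (z ^ m)
  have := hasSum_le (fun j => ?_) h1 h2
  · linarith
  have hz : 0 ≤ z ^ j / z ^ m := by positivity
  rw [← mul_sub, mul_div_assoc]
  refine mul_le_mul_of_nonneg_left ?_ (poissonWeight_nonneg ht j)
  rcases lt_or_ge j m with hj | hj
  · have : 1 ≤ z ^ j / z ^ m :=
      (one_le_div (by positivity)).2 (pow_le_pow_of_le_one hz0.le hz1 hj.le)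
    linarith [(hB.pow j).sum_le_one x A, tvDist_nonneg ((B ^ m) x) π,
      Finset.sum_nonneg fun y (_ : y ∈ A) => hπ0 y]
  · obtain ⟨k, rfl⟩ := Nat.exists_eq_add_of_le hj
    have h3 : tvDist ((B ^ (m + k)) x) π ≤ tvDist ((B ^ m) x) π := by
      rw [pow_add]
      exact (hB.pow m).tvDist_mul_le (hB.pow k) hπ1 (stationary_pow hπ k) x
    linarith [sum_sub_sum_le_tvDist ((B ^ (m + k)) x) π A]

lemma factorial_le_of_le {k m : ℕ} (hk : 0 < k) (hkm : k ≤ m) :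
    (m.factorial : ℝ) ≤ k.factorial * Real.sqrt (m / k) *
      ((m / Real.exp 1) ^ m / (k / Real.exp 1) ^ k) := by
  have hm : 0 < m := hk.trans_le hkm
  have hk' : (0 : ℝ) < k := by exact_mod_cast hk
  have hm' : (0 : ℝ) < m := by exact_mod_cast hm
  have h : Stirling.stirlingSeq m ≤ Stirling.stirlingSeq k := by
    obtain ⟨a, rfl⟩ := Nat.exists_eq_succ_of_ne_zero hk.ne'
    obtain ⟨b, rfl⟩ := Nat.exists_eq_succ_of_ne_zero hm.ne'
    exact Stirling.stirlingSeq'_antitone (Nat.succ_le_succ_iff.1 hkm)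
  rw [Stirling.stirlingSeq, div_le_iff₀ (by positivity)] at h
  refine h.trans_eq ?_
  rw [Stirling.stirlingSeq]
  rw [Real.sqrt_div hm'.le, Real.sqrt_mul zero_le_two, Real.sqrt_mul zero_le_two]
  field_simp

/-- A binomial weight is at most a constant times the Poisson weight with the same mean, away
from the upper tail. -/
lemma choose_mul_le_poissonWeight {δ : ℝ} (hδ : 0 < δ) (hδ1 : δ ≤ 1) {j k : ℕ} (hk : 0 < k)
    (hkδ : δ / 2 * (j + k : ℕ) ≤ k) :
    ((j + k).choose j : ℝ) * (1 - δ) ^ j * δ ^ k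
      ≤ Real.sqrt (2 / δ) * poissonWeight ((1 - δ) * (j + k : ℕ)) j := by
  set m := j + k with hm
  have hm0 : 0 < m := by omega
  have hk' : (0 : ℝ) < k := by exact_mod_cast hk
  have hm' : (0 : ℝ) < m := by exact_mod_cast hm0
  have h1δ : 0 ≤ 1 - δ := by linarith
  have hchoose : (m.choose j : ℝ) = m.factorial / (j.factorial * k.factorial) := by
    rw [eq_div_iff (by positivity)]
    have := Nat.add_choose_mul_factorial_mul_factorial k j
    rw [add_comm k j, ← hm] at this
    rw [mul_comm (j.factorial : ℝ), ← mul_assoc]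
    exact_mod_cast this
  have hfac := factorial_le_of_le hk (show k ≤ m by omega)
  have hsqrt : Real.sqrt (m / k) ≤ Real.sqrt (2 / δ) := by
    refine Real.sqrt_le_sqrt ?_
    rw [div_le_div_iff₀ hk' hδ]
    linarith
  have hexp : (δ * m / k) ^ k ≤ Real.exp (δ * m - k) := by
    have h := Real.add_one_le_exp (δ * m / k - 1)
    rw [sub_add_cancel] at h
    refine (pow_le_pow_left₀ (by positivity) h k).trans_eq ?_
    rw [← Real.exp_nat_mul]
    congr 1
    field_simp
  have key : (m / Real.exp 1) ^ m / (k / Real.exp 1) ^ k * δ ^ k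
      ≤ Real.exp (-((1 - δ) * m)) * m ^ j := by
    have e1 : (m / Real.exp 1) ^ m / (k / Real.exp 1) ^ k * δ ^ k
        = (δ * m / k) ^ k * (Real.exp (k - m) * m ^ j) := by
      rw [Real.exp_sub, ← Real.exp_one_pow k, ← Real.exp_one_pow m, div_pow, div_pow, div_pow,
        mul_pow, show ((m : ℝ) ^ m) = m ^ j * m ^ k by rw [← pow_add]]
      field_simp
    rw [e1]
    refine (mul_le_mul_of_nonneg_right hexp (by positivity)).trans_eq ?_
    rw [← mul_assoc, ← Real.exp_add]
    congr 2; ring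
  have hnum : (m.factorial : ℝ) * δ ^ k
      ≤ k.factorial * (Real.sqrt (2 / δ) * (Real.exp (-((1 - δ) * m)) * m ^ j)) := by
    calc (m.factorial : ℝ) * δ ^ k
        ≤ k.factorial * Real.sqrt (m / k) *
          ((m / Real.exp 1) ^ m / (k / Real.exp 1) ^ k) * δ ^ k := by gcongr
      _ = k.factorial * (Real.sqrt (m / k) *
          ((m / Real.exp 1) ^ m / (k / Real.exp 1) ^ k * δ ^ k)) := by ring
      _ ≤ _ := by gcongr
  rw [hchoose, poissonWeight, mul_pow]
  calc (m.factorial : ℝ) / (j.factorial * k.factorial) * (1 - δ) ^ j * δ ^ k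
      = (1 - δ) ^ j / (j.factorial * k.factorial) * (m.factorial * δ ^ k) := by ring
    _ ≤ (1 - δ) ^ j / (j.factorial * k.factorial) *
        (k.factorial * (Real.sqrt (2 / δ) * (Real.exp (-((1 - δ) * m)) * m ^ j))) := by gcongr
    _ = _ := by field_simp

/-- The error term in comparing the powers of a lazy kernel with its semigroup. -/
def lazyError (δ : ℝ) : ℝ := (2 : ℝ) ^ (δ / 2) * (1 - δ / 2)

lemma lazyError_nonneg {δ : ℝ} (hδ1 : δ ≤ 1) : 0 ≤ lazyError δ :=
  mul_nonneg (by positivity) (by linarith)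

lemma lazyError_lt_one {δ : ℝ} (hδ : 0 < δ) (hδ1 : δ ≤ 1) : lazyError δ < 1 := by
  have h1 : 1 - δ / 2 ≤ Real.exp (-(δ / 2)) := by linarith [Real.add_one_le_exp (-(δ / 2))]
  have h2 : (2 : ℝ) ^ (δ / 2) < Real.exp (δ / 2) := by
    rw [Real.rpow_def_of_pos two_pos]
    refine Real.exp_lt_exp.2 ?_
    nlinarith [Real.log_two_lt_d9]
  calc lazyError δ < Real.exp (δ / 2) * (1 - δ / 2) :=
        mul_lt_mul_of_pos_right h2 (by linarith)
    _ ≤ Real.exp (δ / 2) * Real.exp (-(δ / 2)) := by gcongr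
    _ = 1 := by rw [← Real.exp_add]; simp

lemma sum_lazy_pow_le {B : Matrix ι ι ℝ} (hB : IsStochastic B) {δ : ℝ} (hδ : 0 < δ)
    (hδ1 : δ ≤ 1) {m : ℕ} (hm : 0 < m) (x : ι) (A : Finset ι) :
    ∑ y ∈ A, ((δ • (1 : Matrix ι ι ℝ) + (1 - δ) • B) ^ m) x y
      ≤ Real.sqrt (2 / δ) * ∑ y ∈ A, expSemigroup B ((1 - δ) * m) x y + lazyError δ ^ m := by
  set C := Real.sqrt (2 / δ)
  have h1δ : 0 ≤ 1 - δ := by linarith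
  have hexpand : ∑ y ∈ A, ((δ • (1 : Matrix ι ι ℝ) + (1 - δ) • B) ^ m) x y
      = ∑ j ∈ Finset.range (m + 1),
        (m.choose j * (1 - δ) ^ j * δ ^ (m - j)) * ∑ y ∈ A, (B ^ j) x y := by
    have h := fun y => lazy_pow_apply B (1 - δ) m x y
    simp only [sub_sub_cancel] at h
    simp only [h, Finset.mul_sum]
    exact Finset.sum_comm
  have hterm : ∀ j ∈ Finset.range (m + 1),
      (m.choose j * (1 - δ) ^ j * δ ^ (m - j)) * ∑ y ∈ A, (B ^ j) x y
        ≤ C * (poissonWeight ((1 - δ) * m) j * ∑ y ∈ A, (B ^ j) x y)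
          + (2 : ℝ) ^ (δ / 2 * m) * ((1 - δ) ^ j * (δ / 2) ^ (m - j) * m.choose j) := by
    intro j hj
    obtain ⟨k, rfl⟩ : ∃ k, m = j + k := ⟨m - j, by have := Finset.mem_range.1 hj; omega⟩
    rw [Nat.add_sub_cancel_left]
    have hA0 := (hB.pow j).sum_nonneg x A
    have hA1 := (hB.pow j).sum_le_one x A
    have hP := poissonWeight_nonneg (t := (1 - δ) * (j + k : ℕ)) (by positivity) j
    by_cases hk : δ / 2 * (j + k : ℕ) ≤ k
    · have hk0 : 0 < k := by
        have : (0 : ℝ) < k := lt_of_lt_of_le (by positivity) hk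
        exact_mod_cast this
      have h := mul_le_mul_of_nonneg_right
        (choose_mul_le_poissonWeight hδ hδ1 hk0 hk) hA0
      have h0 : 0 ≤ (2 : ℝ) ^ (δ / 2 * (j + k : ℕ)) *
        ((1 - δ) ^ j * (δ / 2) ^ k * (j + k).choose j) := by positivity
      rw [mul_assoc C] at h
      linarith
    · have h2 : (1 : ℝ) ≤ (2 : ℝ) ^ (δ / 2 * (j + k : ℕ)) / 2 ^ k := by
        rw [one_le_div (by positivity), ← Real.rpow_natCast]
        exact Real.rpow_le_rpow_of_exponent_le one_le_two (not_le.1 hk).le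
      have h0 : 0 ≤ C * (poissonWeight ((1 - δ) * (j + k : ℕ)) j * ∑ y ∈ A, (B ^ j) x y) :=
        mul_nonneg (Real.sqrt_nonneg _) (mul_nonneg hP hA0)
      have hb : 0 ≤ ((j + k).choose j : ℝ) * (1 - δ) ^ j * δ ^ k := by positivity
      calc _ ≤ ((j + k).choose j : ℝ) * (1 - δ) ^ j * δ ^ k * 1 := by gcongr
        _ ≤ ((j + k).choose j : ℝ) * (1 - δ) ^ j * δ ^ k *
            ((2 : ℝ) ^ (δ / 2 * (j + k : ℕ)) / 2 ^ k) := by gcongr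
        _ = (2 : ℝ) ^ (δ / 2 * (j + k : ℕ)) *
            ((1 - δ) ^ j * (δ / 2) ^ k * (j + k).choose j) := by rw [div_pow]; ring
        _ ≤ _ := by linarith
  rw [hexpand]
  refine (Finset.sum_le_sum hterm).trans ?_
  rw [Finset.sum_add_distrib, ← Finset.mul_sum, ← Finset.mul_sum, ← add_pow,
    show 1 - δ + δ / 2 = 1 - δ / 2 by ring, lazyError, mul_pow, ← Real.rpow_mul_natCast two_pos.le]
  gcongr
  exact sum_le_hasSum _ (fun j _ => mul_nonneg (poissonWeight_nonneg (by positivity) j)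
    ((hB.pow j).sum_nonneg x A)) (hasSum_sum_expSemigroup B ((1 - δ) * m) x A)

/-- Powers of a kernel with diagonal bounded below are dominated by its semigroup. -/
lemma IsStochastic.sum_pow_le {B : Matrix ι ι ℝ} (hB : IsStochastic B) {δ : ℝ} (hδ : 0 < δ)
    (hδ1 : δ < 1) (hdiag : ∀ i, δ ≤ B i i) {m : ℕ} (hm : 0 < m) (x : ι) (A : Finset ι) :
    ∑ y ∈ A, (B ^ m) x y
      ≤ Real.sqrt (2 / δ) * ∑ y ∈ A, expSemigroup B m x y + lazyError δ ^ m := by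
  have h1δ : 0 < 1 - δ := by linarith
  set B' : Matrix ι ι ℝ := (1 - δ)⁻¹ • (B - δ • 1) with hB'
  have hBB' : (1 - δ) • B' = B - δ • 1 := by rw [hB', smul_smul, mul_inv_cancel₀ h1δ.ne', one_smul]
  have hst : IsStochastic B' := by
    refine ⟨fun i j => ?_, fun i => ?_⟩
    · simp only [hB', Matrix.smul_apply, Matrix.sub_apply, smul_eq_mul]
      refine mul_nonneg (by positivity) ?_
      rcases eq_or_ne i j with rfl | h
      · simpa using hdiag i
      · simpa [h] using hB.nonneg i j
    · simp only [hB', Matrix.smul_apply, Matrix.sub_apply, smul_eq_mul, ← Finset.mul_sum,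
        Finset.sum_sub_distrib, hB.rowSum, IsStochastic.one.rowSum, mul_one]
      exact inv_mul_cancel₀ h1δ.ne'
  have hexp : expSemigroup B' ((1 - δ) * m) = expSemigroup B m := by
    rw [expSemigroup, expSemigroup, mul_comm, mul_smul, smul_sub (1 - δ), hBB']
    congr 2
    rw [sub_smul, one_smul]; abel
  have h := sum_lazy_pow_le hst hδ hδ1.le hm x A
  rwa [hexp, hBB', add_sub_cancel] at h

end Comparison

section Reversible

variable {ι : Type*} [Fintype ι] [DecidableEq ι] {B : Matrix ι ι ℝ} {π : ι → ℝ}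

lemma reversible_pow (hrev : ∀ x y, π x * B x y = π y * B y x) (m : ℕ) (x y : ι) :
    π x * (B ^ m) x y = π y * (B ^ m) y x := by
  induction m generalizing x y with
  | zero =>
    rcases eq_or_ne x y with rfl | h
    · rfl
    · simp [h, h.symm]
  | succ m ih =>
    rw [pow_succ, Matrix.mul_apply, ← pow_succ, pow_succ', Matrix.mul_apply, Finset.mul_sum,
      Finset.mul_sum]
    refine Finset.sum_congr rfl fun z _ => ?_
    rw [← mul_assoc, ih, mul_right_comm, hrev z y]
    ring

/-- A reversible kernel is diagonalized by a basis that is orthonormal for the reversing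
measure. -/
lemma exists_eigenbasis_of_reversible (hπ : ∀ x, 0 < π x)
    (hrev : ∀ x y, π x * B x y = π y * B y x) :
    ∃ (ψ : ι → ι → ℝ) (b : ι → ℝ), (∀ i, B *ᵥ ψ i = b i • ψ i) ∧
      ∀ f : ι → ℝ, ∑ x, π x * f x ^ 2 = ∑ i, (∑ x, π x * ψ i x * f x) ^ 2 := by
  set s : ι → ℝ := fun x => Real.sqrt (π x) with hs
  have hs0 : ∀ x, s x ≠ 0 := fun x => (Real.sqrt_pos.2 (hπ x)).ne'
  have hs2 : ∀ x, s x * s x = π x := fun x => Real.mul_self_sqrt (hπ x).le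
  set A : Matrix ι ι ℝ := Matrix.of fun x y => s x * B x y / s y with hAdef
  have hA : A.IsHermitian := by
    ext x y
    simp only [Matrix.conjTranspose_apply, hAdef, Matrix.of_apply, star_trivial]
    rw [div_eq_div_iff (hs0 _) (hs0 _)]
    linear_combination hrev y x + B y x * hs2 y - B x y * hs2 x
  set u := hA.eigenvectorBasis
  refine ⟨fun i x => u i x / s x, hA.eigenvalues, fun i => ?_, fun f => ?_⟩
  · funext x
    have h := congrFun (hA.mulVec_eigenvectorBasis i) x
    simp only [Matrix.mulVec, dotProduct, hAdef, Matrix.of_apply, Pi.smul_apply,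
      smul_eq_mul] at h ⊢
    rw [← mul_div_assoc, eq_div_iff (hs0 x), ← h, Finset.sum_mul]
    exact Finset.sum_congr rfl fun y _ => by ring
  · have h := u.sum_sq_norm_inner_right (WithLp.toLp 2 fun x => s x * f x)
    rw [EuclideanSpace.real_norm_sq_eq] at h
    simp only [Real.norm_eq_abs, sq_abs, PiLp.inner_apply, RCLike.inner_apply, conj_trivial] at h
    convert! h.symm using 1
    · exact Finset.sum_congr rfl fun x _ => by rw [← hs2]; ring
    · refine Finset.sum_congr rfl fun i _ => ?_
      congr 1
      refine Finset.sum_congr rfl fun x _ => ?_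
      rw [← hs2]
      have := hs0 x
      field_simp

/-- Contraction in `L²(π)` of the powers of a reversible kernel on mean-zero functions. -/
lemma sum_sq_pow_mulVec_le (hπ : ∀ x, 0 < π x) (hrev : ∀ x y, π x * B x y = π y * B y x)
    {m : ℕ} {ρ : ℝ}
    (hρ : ∀ (f : ι → ℝ) (b : ℝ), B *ᵥ f = b • f → (∃ x y, f x ≠ f y) → |b| ^ m ≤ ρ)
    {f : ι → ℝ} (hf : ∑ x, π x * f x = 0) :
    ∑ x, π x * ((B ^ m *ᵥ f) x) ^ 2 ≤ ρ ^ 2 * ∑ x, π x * f x ^ 2 := by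
  obtain ⟨ψ, b, hψ, hpars⟩ := exists_eigenbasis_of_reversible hπ hrev
  rw [hpars, hpars, Finset.mul_sum]
  refine Finset.sum_le_sum fun i _ => ?_
  have hcoef : ∑ x, π x * ψ i x * (B ^ m *ᵥ f) x = b i ^ m * ∑ x, π x * ψ i x * f x := by
    have h := congrFun (pow_mulVec_of_eigen (hψ i) m)
    simp only [Matrix.mulVec, dotProduct, Pi.smul_apply, smul_eq_mul] at h ⊢
    simp only [Finset.mul_sum]
    rw [Finset.sum_comm]
    refine Finset.sum_congr rfl fun y _ => ?_
    have : b i ^ m * (π y * ψ i y * f y) = π y * f y * (b i ^ m * ψ i y) := by ring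
    rw [this, ← h y, Finset.mul_sum]
    refine Finset.sum_congr rfl fun x _ => ?_
    linear_combination ψ i x * f y * reversible_pow hrev m x y
  rw [hcoef, mul_pow]
  by_cases hc : ∃ x y, ψ i x ≠ ψ i y
  · refine mul_le_mul_of_nonneg_right ?_ (sq_nonneg _)
    rw [← sq_abs, abs_pow]
    exact pow_le_pow_left₀ (by positivity) (hρ _ _ (hψ i) hc) 2
  · push Not at hc
    have : ∑ x, π x * ψ i x * f x = 0 := by
      rcases isEmpty_or_nonempty ι with h | ⟨⟨x₀⟩⟩
      · simp
      · calc ∑ x, π x * ψ i x * f x = ψ i x₀ * ∑ x, π x * f x := by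
              rw [Finset.mul_sum]
              exact Finset.sum_congr rfl fun x _ => by rw [hc x x₀]; ring
          _ = 0 := by rw [hf, mul_zero]
    simp [this]

/-- A measure dominated, up to small error, by a multiple of `π` is brought close to `π` by the
powers of a reversible kernel. -/
lemma IsStochastic.sum_mul_pow_sub_le (hB : IsStochastic B) (hπ : ∀ x, 0 < π x)
    (hπ1 : ∑ x, π x = 1) (hrev : ∀ x y, π x * B x y = π y * B y x)
    {m : ℕ} {ρ : ℝ} (hρ0 : 0 ≤ ρ)
    (hρ : ∀ (f : ι → ℝ) (b : ℝ), B *ᵥ f = b • f → (∃ x y, f x ≠ f y) → |b| ^ m ≤ ρ)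
    {μ : ι → ℝ} (hμ0 : ∀ x, 0 ≤ μ x) (hμ1 : ∑ x, μ x = 1) {C e : ℝ} (hC : 0 ≤ C)
    (hμ : ∀ A : Finset ι, ∑ x ∈ A, μ x ≤ C * ∑ x ∈ A, π x + e) :
    tvDist (fun y => ∑ x, μ x * (B ^ m) x y) π ≤ C * ρ + e := by
  refine tvDist_le fun A => ?_
  set p : ℝ := ∑ y ∈ A, π y with hp
  set f : ι → ℝ := fun y => (if y ∈ A then 1 else 0) - p with hf
  set g : ι → ℝ := B ^ m *ᵥ f with hg
  have hp0 : 0 ≤ p := Finset.sum_nonneg fun y _ => (hπ y).le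
  have hp1 : p ≤ 1 := hπ1 ▸ Finset.sum_le_univ_sum_of_nonneg fun y => (hπ y).le
  have hπf : ∑ x, π x * f x = 0 := by
    simp only [hf, mul_sub, Finset.sum_sub_distrib, ← Finset.sum_mul, hπ1, one_mul]
    rw [← sum_finset_eq_sum_mul_indicator, sub_self]
  have hgx : ∀ x, g x = ∑ y ∈ A, (B ^ m) x y - p := fun x => by
    simp only [hg, hf, Matrix.mulVec, dotProduct, mul_sub, Finset.sum_sub_distrib,
      ← Finset.sum_mul, (hB.pow m).rowSum, one_mul]
    rw [← sum_finset_eq_sum_mul_indicator]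
  have hg1 : ∀ x, |g x| ≤ 1 := fun x => by
    rw [hgx, abs_le]
    constructor <;> linarith [(hB.pow m).sum_nonneg x A, (hB.pow m).sum_le_one x A]
  have hval : ∑ y ∈ A, ∑ x, μ x * (B ^ m) x y - p = ∑ x, μ x * g x := by
    simp only [hgx, mul_sub, Finset.sum_sub_distrib, ← Finset.sum_mul, hμ1, one_mul]
    rw [Finset.sum_comm]
    simp only [Finset.mul_sum]
  have hf2 : ∑ x, π x * f x ^ 2 ≤ 1 := by
    rw [← hπ1]
    refine Finset.sum_le_sum fun x _ => mul_le_of_le_one_right (hπ x).le ?_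
    simp only [hf]
    split_ifs <;> nlinarith
  have hl1 : ∑ x, π x * |g x| ≤ ρ := by
    refine abs_le_of_sq_le_sq' ?_ hρ0 |>.2
    have hcs := Finset.sum_mul_sq_le_sq_mul_sq Finset.univ (fun x => Real.sqrt (π x))
      (fun x => Real.sqrt (π x) * |g x|)
    simp only [mul_pow, sq_abs, Real.sq_sqrt (hπ _).le, hπ1, one_mul, ← mul_assoc,
      Real.mul_self_sqrt (hπ _).le] at hcs
    refine hcs.trans ((sum_sq_pow_mulVec_le hπ hrev hρ hπf).trans ?_)
    exact mul_le_of_le_one_right (sq_nonneg _) hf2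
  set S : Finset ι := Finset.univ.filter fun x => C * π x < μ x with hS
  have hpt : ∀ x, μ x * g x ≤ C * (π x * |g x|) + (μ x - C * π x) * if x ∈ S then 1 else 0 := by
    intro x
    have h1 : μ x * g x ≤ μ x * |g x| := mul_le_mul_of_nonneg_left (le_abs_self _) (hμ0 x)
    have h2 := abs_nonneg (g x)
    by_cases hx : C * π x < μ x
    · simp only [hS, Finset.mem_filter, Finset.mem_univ, true_and, hx, if_true]
      nlinarith [hg1 x]
    · simp only [hS, Finset.mem_filter, Finset.mem_univ, true_and, hx, if_false]
      nlinarith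
  rw [hval]
  refine (Finset.sum_le_sum fun x _ => hpt x).trans ?_
  rw [Finset.sum_add_distrib, ← Finset.mul_sum,
    ← sum_finset_eq_sum_mul_indicator (fun x => μ x - C * π x) S, Finset.sum_sub_distrib,
    ← Finset.mul_sum]
  have := hμ S
  have := mul_le_mul_of_nonneg_left hl1 hC
  linarith

/-- Eigenvalues of a stochastic matrix are at most `1`, and bounded below in terms of the
diagonal. -/
lemma IsStochastic.eigen_mem_Icc (hB : IsStochastic B) {δ : ℝ}
    (hδ : ∀ i, δ ≤ B i i) {f : ι → ℝ} {b : ℝ} (h : B *ᵥ f = b • f) (hf : f ≠ 0) :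
    b ∈ Set.Icc (2 * δ - 1) 1 := by
  obtain ⟨x₁, hx₁⟩ := Function.ne_iff.1 hf
  obtain ⟨x, -, hx⟩ := Finset.exists_max_image Finset.univ (fun x => |f x|) ⟨x₁, Finset.mem_univ _⟩
  have hx0 : 0 < |f x| := (abs_pos.2 hx₁).trans_le (hx x₁ (Finset.mem_univ _))
  have h1 := congrFun h x
  simp only [Matrix.mulVec, dotProduct, Pi.smul_apply, smul_eq_mul] at h1
  rw [← Finset.add_sum_erase _ _ (Finset.mem_univ x)] at h1
  have h2 := hB.rowSum x
  rw [← Finset.add_sum_erase _ _ (Finset.mem_univ x)] at h2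
  have h3 : |∑ y ∈ Finset.univ.erase x, B x y * f y| ≤ (1 - B x x) * |f x| := by
    refine (Finset.abs_sum_le_sum_abs _ _).trans ?_
    rw [← h2, add_sub_cancel_left, Finset.sum_mul]
    refine Finset.sum_le_sum fun y _ => ?_
    rw [abs_mul, abs_of_nonneg (hB.nonneg x y)]
    exact mul_le_mul_of_nonneg_left (hx y (Finset.mem_univ _)) (hB.nonneg x y)
  rw [show ∑ y ∈ Finset.univ.erase x, B x y * f y = (b - B x x) * f x by linarith, abs_mul] at h3
  have h4 := abs_le.1 (le_of_mul_le_mul_right h3 hx0)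
  constructor <;> linarith [hδ x]

/-- Uniform closeness to stationarity bounds the nontrivial eigenvalues of the semigroup. -/
lemma IsStochastic.exp_eigen_le (hB : IsStochastic B) (hπ1 : ∑ x, π x = 1)
    {t a : ℝ} (ht : 0 ≤ t) (ha : ∀ x, tvDist (expSemigroup B t x) π ≤ a)
    {f : ι → ℝ} {b : ℝ} (h : B *ᵥ f = b • f) (hf : ∃ x y, f x ≠ f y) :
    Real.exp (-(1 - b) * t) ≤ 2 * a := by
  obtain ⟨x₁, y₁, hxy⟩ := hf
  obtain ⟨M, -, hM⟩ := Finset.exists_max_image Finset.univ f ⟨x₁, Finset.mem_univ _⟩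
  obtain ⟨m, -, hm⟩ := Finset.exists_min_image Finset.univ f ⟨x₁, Finset.mem_univ _⟩
  replace hM := fun x => hM x (Finset.mem_univ _)
  replace hm := fun x => hm x (Finset.mem_univ _)
  have hw : 0 < f M - f m := by
    rcases lt_or_gt_of_ne hxy with h' | h' <;> linarith [hM x₁, hM y₁, hm x₁, hm y₁]
  have hst := hB.semigroup ht
  have hmass : ∀ x, ∑ y, expSemigroup B t x y = ∑ y, π y := fun x => by rw [hst.rowSum, hπ1]
  have heig := congrFun (expSemigroup_mulVec_of_eigen h t)
  simp only [Matrix.mulVec, dotProduct, Pi.smul_apply, smul_eq_mul] at heig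
  have h1 := sum_sub_mul_le_mul_tvDist (hmass M) (f := f) (a := f m) (w := f M - f m)
    hm (fun x => by linarith [hM x])
  have h2 := sum_sub_mul_le_mul_tvDist (hmass m) (f := fun x => -f x) (a := -f M)
    (w := f M - f m) (fun x => by linarith [hM x]) (fun x => by linarith [hm x])
  simp only [mul_neg, Finset.sum_neg_distrib] at h2
  rw [heig] at h1 h2
  have h3 := mul_le_mul_of_nonneg_left (ha M) hw.le
  have h4 := mul_le_mul_of_nonneg_left (ha m) hw.le
  refine le_of_mul_le_mul_right (a := f M - f m) ?_ hw
  linarith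

end Reversible

namespace BDChain

variable {n : ℕ} (c : BDChain n)

lemma reversible (x y : Fin (n + 1)) : c.pi x * c.K x y = c.pi y * c.K y x := by
  wlog hxy : x < y generalizing x y
  · rcases (not_lt.1 hxy).eq_or_lt with rfl | h
    · rfl
    · exact (this y x h).symm
  set a : Fin (n + 1) → Fin (n + 1) → ℝ := fun i j => c.pi i * c.K i j - c.pi j * c.K j i with ha
  have hanti : ∀ i j, a i j = -a j i := fun i j => by simp only [ha]; ring
  have hrow : ∀ i, ∑ j, a i j = 0 := fun i => by
    simp only [ha, Finset.sum_sub_distrib, ← Finset.mul_sum, c.K_rowSum, c.pi_stat]; ring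
  have hfar : ∀ i j : Fin (n + 1), (i : ℕ) + 1 < j → a i j = 0 := fun i j h => by
    have h1 : 1 < |(i : ℤ) - (j : ℤ)| := by rw [lt_abs]; omega
    have h2 : 1 < |(j : ℤ) - (i : ℤ)| := by rw [lt_abs]; omega
    simp [ha, c.K_tridiag _ _ h1, c.K_tridiag _ _ h2]
  suffices h : a x y = 0 from sub_eq_zero.1 h
  by_cases hadj : (x : ℕ) + 1 < y
  · exact hfar x y hadj
  have hin : ∑ i ∈ Finset.Iic x, ∑ j ∈ Finset.Iic x, a i j = 0 := by
    have h1 : ∑ i ∈ Finset.Iic x, ∑ j ∈ Finset.Iic x, a i j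
        = -∑ i ∈ Finset.Iic x, ∑ j ∈ Finset.Iic x, a i j := by
      conv_lhs => rw [Finset.sum_comm]
      simp only [← Finset.sum_neg_distrib, ← hanti]
    linarith
  have hout : ∑ i ∈ Finset.Iic x, ∑ j ∈ Finset.univ.filter (fun j => ¬ j ∈ Finset.Iic x), a i j
      = 0 := by
    have h1 : ∑ i ∈ Finset.Iic x, ∑ j, a i j = 0 := Finset.sum_eq_zero fun i _ => hrow i
    simp only [← Finset.sum_filter_add_sum_filter_not Finset.univ (fun j => j ∈ Finset.Iic x),
      Finset.sum_add_distrib] at h1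
    rw [Finset.filter_mem_eq_inter, Finset.univ_inter, hin, zero_add] at h1
    exact h1
  rw [Finset.sum_eq_single x, Finset.sum_eq_single y] at hout
  · exact hout
  · intro j hj hne
    refine hfar x j ?_
    simp only [Finset.mem_filter, Finset.mem_Iic, Fin.le_def] at hj
    rw [Fin.lt_def] at hxy
    rw [Ne, Fin.ext_iff] at hne
    omega
  · intro hy
    simp [hxy] at hy
  · intro i hi hne
    refine Finset.sum_eq_zero fun j hj => hfar i j ?_
    simp only [Finset.mem_filter, Finset.mem_Iic, Fin.le_def] at hi hj
    rw [Ne, Fin.ext_iff] at hne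
    omega
  · simp

/-- Discrete-time mixing shortly after the continuous-time chain has mixed from all states. -/
lemma dTV_add_le {δ : ℝ} (hδ0 : 0 < δ) (hδ1 : δ < 1) (hδ : ∀ i, δ ≤ c.K i i) {m v : ℕ}
    (hm : 0 < m) {η a : ℝ} (hη : 0 < η) (hv : η * m ≤ v) (ha : ∀ x, c.dTVC x m ≤ a)
    (x : Fin (n + 1)) :
    c.dTV x (m + v) ≤ Real.sqrt (2 / δ) * (Real.exp (-(2 * δ) * v) + (2 * a) ^ η)
      + (Real.sqrt (2 / δ) * a + lazyError δ ^ m) := by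
  have hst := c.isStochastic
  simp only [dTVC_eq_tvDist] at ha
  have ha0 : 0 ≤ a := (tvDist_nonneg _ _).trans (ha x)
  have hpow : (c.K ^ (m + v)) x = fun y => ∑ z, (c.K ^ m) x z * (c.K ^ v) z y := by
    funext y; rw [pow_add, Matrix.mul_apply]
  rw [dTV_eq_tvDist, hpow]
  refine hst.sum_mul_pow_sub_le c.pi_pos c.pi_sum c.reversible (by positivity) ?_
    ((hst.pow m).nonneg x) ((hst.pow m).rowSum x) (Real.sqrt_nonneg _) fun A => ?_
  · intro f b hfb hf
    obtain ⟨hlow, hb1⟩ := hst.eigen_mem_Icc hδ hfb (by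
      rintro rfl; simp at hf)
    have hup := hst.exp_eigen_le c.pi_sum (Nat.cast_nonneg m) ha hfb hf
    rcases le_total 0 b with hb | hb
    · have h1 : |b| ^ v ≤ Real.exp (-(1 - b) * m) ^ η := by
        rw [abs_of_nonneg hb, ← Real.exp_mul]
        have h2 : b ≤ Real.exp (-(1 - b)) := by linarith [Real.add_one_le_exp (-(1 - b))]
        refine (pow_le_pow_left₀ hb h2 v).trans ?_
        rw [← Real.exp_nat_mul]
        refine Real.exp_le_exp.2 ?_
        nlinarith
      have h2 : Real.exp (-(1 - b) * m) ^ η ≤ (2 * a) ^ η :=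
        Real.rpow_le_rpow (Real.exp_nonneg _) hup hη.le
      linarith [Real.exp_nonneg (-(2 * δ) * v)]
    · have h1 : |b| ^ v ≤ Real.exp (-(2 * δ) * v) := by
        rw [mul_comm, Real.exp_nat_mul]
        refine pow_le_pow_left₀ (abs_nonneg b) ?_ v
        rw [abs_of_nonpos hb]
        linarith [Real.add_one_le_exp (-(2 * δ))]
      have : 0 ≤ (2 * a) ^ η := by positivity
      linarith
  · have h1 := hst.sum_pow_le hδ0 hδ1 hδ hm x A
    have h2 := (sum_sub_sum_le_tvDist (expSemigroup c.K m x) c.pi A).trans (ha x)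
    have h3 : Real.sqrt (2 / δ) * ∑ y ∈ A, expSemigroup c.K m x y
        ≤ Real.sqrt (2 / δ) * (∑ y ∈ A, c.pi y + a) := by gcongr; linarith
    linarith

end BDChain

section Cutoff

variable {T TL TR : ℝ → ℕ → ℝ} {r s t : ℕ → ℝ}

lemma cutoffWith.eventually_bounds (h : cutoffWith T t) (ht : ∀ n, 0 < t n) {ε : ℝ}
    (hε : ε ∈ Set.Ioo (0 : ℝ) 1) {η : ℝ} (hη : 0 < η) :
    ∀ᶠ n in atTop, (1 - η) * t n < T ε n ∧ T ε n < (1 + η) * t n := by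
  filter_upwards [(h ε hε).eventually (Ioo_mem_nhds (show 1 - η < 1 by linarith)
    (show (1 : ℝ) < 1 + η by linarith))] with n hn
  exact ⟨(lt_div_iff₀ (ht n)).1 hn.1, (div_lt_iff₀ (ht n)).1 hn.2⟩

lemma cutoffWith.eventually_pos (h : cutoffWith T t) (ht : ∀ n, 0 < t n) {ε : ℝ}
    (hε : ε ∈ Set.Ioo (0 : ℝ) 1) : ∀ᶠ n in atTop, 0 < T ε n := by
  filter_upwards [h.eventually_bounds ht hε one_half_pos] with n hn
  linarith [hn.1, ht n]

lemma cutoffWith_of_eventually_bounds (ht : ∀ n, 0 < t n)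
    (h : ∀ ε ∈ Set.Ioo (0 : ℝ) 1, ∀ η > 0,
      ∀ᶠ n in atTop, (1 - η) * t n ≤ T ε n ∧ T ε n ≤ (1 + η) * t n) : cutoffWith T t := by
  intro ε hε
  rw [Metric.tendsto_nhds]
  intro η hη
  filter_upwards [h ε hε (η / 2) (half_pos hη)] with n hn
  have h1 := (le_div_iff₀ (ht n)).2 hn.1
  have h2 := (div_le_iff₀ (ht n)).2 hn.2
  rw [Real.dist_eq, abs_lt]
  constructor <;> linarith

/-- A profile that dominates two profiles with cutoffs, and is asymptotically dominated by the
maximum of their cutoff times, has a cutoff at that maximum. -/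
lemma cutoffWith_max (hr : ∀ n, 0 < r n) (hs : ∀ n, 0 < s n) (hL : cutoffWith TL r)
    (hR : cutoffWith TR s)
    (hlow : ∀ ε ∈ Set.Ioo (0 : ℝ) 1, ∀ᶠ n in atTop, TL ε n ≤ T ε n ∧ TR ε n ≤ T ε n)
    (hup : ∀ ε ∈ Set.Ioo (0 : ℝ) 1, ∀ η > 0,
      ∀ᶠ n in atTop, T ε n ≤ (1 + η) * max (r n) (s n)) :
    cutoffWith T fun n => max (r n) (s n) := by
  refine cutoffWith_of_eventually_bounds (fun n => lt_max_of_lt_left (hr n)) fun ε hε η hη => ?_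
  filter_upwards [hlow ε hε, hup ε hε η hη, hL.eventually_bounds hr hε hη,
    hR.eventually_bounds hs hε hη] with n h1 h2 h3 h4
  refine ⟨?_, h2⟩
  rcases max_choice (r n) (s n) with h | h <;> rw [h]
  · exact h3.1.le.trans h1.1
  · exact h4.1.le.trans h1.2

/-- If monotone continuous-time distance profiles have a cutoff at `t`, they are small after
time `(1 + η) t`. -/
lemma cutoffWith.eventually_le_of_mixC {d : ℕ → ℝ → ℝ} (hd : ∀ n, AntitoneOn (d n) (Set.Ici 0))
    (h : cutoffWith (fun ε n => mixC (d n) ε) t) (ht : ∀ n, 0 < t n) {ε : ℝ}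
    (hε : ε ∈ Set.Ioo (0 : ℝ) 1) {η : ℝ} (hη : 0 < η) :
    ∀ᶠ n in atTop, ∀ u, (1 + η) * t n ≤ u → d n u ≤ ε := by
  filter_upwards [h.eventually_bounds ht hε hη, h.eventually_pos ht hε] with n hn hpos u hu
  have hne : {u : ℝ | 0 ≤ u ∧ d n u ≤ ε}.Nonempty := by
    by_contra hne
    rw [Set.not_nonempty_iff_eq_empty] at hne
    simp [mixC, hne] at hpos
  obtain ⟨w, ⟨hw0, hw⟩, hwu⟩ := exists_lt_of_csInf_lt hne hn.2
  have hw' : w ≤ u := hwu.le.trans hu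
  exact (hd n hw0 (hw0.trans hw') hw').trans hw

lemma bddBelow_mixC_set (d : ℝ → ℝ) (ε : ℝ) : BddBelow {u : ℝ | 0 ≤ u ∧ d u ≤ ε} :=
  ⟨0, fun _ hu => hu.1⟩

lemma le_of_mixD_le {d : ℕ → ℝ} (hd : Antitone d) {ε : ℝ} (hpos : 0 < mixD d ε) {m : ℕ}
    (hm : mixD d ε ≤ m) : d m ≤ ε :=
  (hd hm).trans (Nat.sInf_mem (Nat.nonempty_of_pos_sInf hpos))

end Cutoff

lemma exists_small_rpow {C ε η : ℝ} (hη : 0 < η) (hε : 0 < ε) :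
    ∃ α ∈ Set.Ioo (0 : ℝ) 1, C * (2 * (8 * α)) ^ η + C * (8 * α) < ε := by
  have hcont : Continuous fun α : ℝ => C * (2 * (8 * α)) ^ η + C * (8 * α) :=
    ((continuous_const.mul ((Real.continuous_rpow_const hη.le).comp (by fun_prop))).add
      (by fun_prop))
  have h0 := hcont.tendsto 0
  simp only [mul_zero, Real.zero_rpow hη.ne', add_zero] at h0
  have h1 := (h0.eventually (gt_mem_nhds hε)).filter_mono
    (nhdsWithin_le_nhds (s := Set.Ioi (0 : ℝ)))
  obtain ⟨α, h2, h3⟩ := (h1.and (Ioo_mem_nhdsGT one_pos)).exists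
  exact ⟨α, h3, h2⟩

namespace BDChain

variable {n : ℕ} (c : BDChain n)

lemma dTV_le_dTVMax (x : Fin (n + 1)) (m : ℕ) : c.dTV x m ≤ c.dTVMax m :=
  le_ciSup (f := fun x => c.dTV x m) (Set.finite_range _).bddAbove x

lemma dTVC_le_dTVMaxC (x : Fin (n + 1)) (t : ℝ) : c.dTVC x t ≤ c.dTVMaxC t :=
  le_ciSup (f := fun x => c.dTVC x t) (Set.finite_range _).bddAbove x

lemma dTVC_le_dTV_add {η : ℝ} (hη : 0 < η) (x : Fin (n + 1)) {M m : ℕ}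
    (hm : (1 + η) * M ≤ m) :
    c.dTVC x m ≤ c.dTV x M + (Real.exp (-η) * (1 + η)) ^ M := by
  have h1η : 0 < 1 + η := by linarith
  have ht : 0 ≤ (1 + η) * M := by positivity
  refine (c.dTVC_antitoneOn x ht (ht.trans hm) hm).trans ?_
  rw [dTVC_eq_tvDist, dTV_eq_tvDist]
  refine (c.isStochastic.tvDist_expSemigroup_le (fun x => (c.pi_pos x).le) c.pi_sum c.pi_stat ht
    (inv_pos.2 h1η) (inv_le_one_of_one_le₀ (by linarith)) x M).trans_eq ?_
  rw [inv_pow, div_inv_eq_mul, mul_pow, ← Real.exp_nat_mul]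
  congr 3
  field_simp
  ring

lemma pow_le_pow_apply_self {δ : ℝ} (hδ0 : 0 ≤ δ) (hδ : ∀ i, δ ≤ c.K i i) (x : Fin (n + 1))
    (m : ℕ) : δ ^ m ≤ (c.K ^ m) x x := by
  induction m with
  | zero => simp
  | succ m ih =>
    rw [pow_succ, pow_succ, Matrix.mul_apply]
    have h0 := (c.isStochastic.pow m).nonneg x
    exact (mul_le_mul ih (hδ x) hδ0 (h0 x)).trans <|
      Finset.single_le_sum (f := fun z => (c.K ^ m) x z * c.K z x)
        (fun z _ => mul_nonneg (h0 z) (c.K_nonneg z x)) (Finset.mem_univ x)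

lemma pow_apply_sub_pi_le_dTV (x : Fin (n + 1)) (m : ℕ) :
    (c.K ^ m) x x - c.pi x ≤ c.dTV x m := by
  simpa [dTV_eq_tvDist] using sum_sub_sum_le_tvDist ((c.K ^ m) x) c.pi {x}

lemma dTV_zero_le (x : Fin (n + 1)) : c.dTV x 0 ≤ 1 - c.pi x := by
  have hle : ∀ A : Finset (Fin (n + 1)), ∑ y ∈ A, c.pi y ≤ 1 := fun A =>
    c.pi_sum ▸ Finset.sum_le_univ_sum_of_nonneg fun y => (c.pi_pos y).le
  refine ciSup_le fun A => ?_
  simp only [pow_zero, Matrix.one_apply, Finset.sum_ite_eq]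
  split_ifs with hx
  · linarith [Finset.single_le_sum (f := c.pi) (fun y _ => (c.pi_pos y).le) hx]
  · have h1 : 0 ≤ ∑ y ∈ A, c.pi y := Finset.sum_nonneg fun y _ => (c.pi_pos y).le
    have h2 : c.pi x ≤ 1 := by simpa using hle {x}
    linarith

/-- For lazy birth and death chains, closeness to stationarity from both end points at time `M`
implies closeness to stationarity from every state slightly later. -/
theorem exists_dTV_le_of_dTV_extremes_le {δ : ℝ} (hδ0 : 0 < δ) (hδ1 : δ < 1) {ε η : ℝ}
    (hε : 0 < ε) (hη : 0 < η) :
    ∃ α ∈ Set.Ioo (0 : ℝ) 1, ∀ᶠ M : ℕ in atTop, ∀ (n : ℕ) (c : BDChain n), (∀ i, δ ≤ c.K i i) →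
      c.dTV 0 M ≤ α → c.dTV (Fin.last n) M ≤ α → ∀ x,
        c.dTV x (⌈(1 + η) * M⌉₊ + ⌈η * ⌈(1 + η) * (M : ℝ)⌉₊⌉₊) ≤ ε := by
  set C := Real.sqrt (2 / δ)
  obtain ⟨α, hα, hαC⟩ := exists_small_rpow (C := C) hη (half_pos hε)
  refine ⟨α, hα, ?_⟩
  have hτ : Real.exp (-η) * (1 + η) < 1 := by
    have h := mul_lt_mul_of_pos_left (Real.add_one_lt_exp hη.ne') (Real.exp_pos (-η))
    rwa [← Real.exp_add, neg_add_cancel, Real.exp_zero, add_comm η] at h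
  have htail := (tendsto_pow_atTop_nhds_zero_of_lt_one (by positivity) hτ).eventually
    (gt_mem_nhds hα.1)
  have hm : Tendsto (fun M : ℕ => ⌈(1 + η) * (M : ℝ)⌉₊) atTop atTop :=
    tendsto_nat_ceil_atTop.comp
      (tendsto_natCast_atTop_atTop.const_mul_atTop (show 0 < 1 + η by linarith))
  have hv : Tendsto (fun M : ℕ => ⌈η * (⌈(1 + η) * (M : ℝ)⌉₊ : ℝ)⌉₊) atTop atTop :=
    tendsto_nat_ceil_atTop.comp
      ((tendsto_natCast_atTop_atTop.comp hm).const_mul_atTop hη)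
  have herr1 := (tendsto_pow_atTop_nhds_zero_of_lt_one (lazyError_nonneg hδ1.le)
    (lazyError_lt_one hδ0 hδ1.le)).comp hm
  have herr2 : Tendsto (fun M : ℕ => Real.exp (-(2 * δ) * ⌈η * (⌈(1 + η) * (M : ℝ)⌉₊ : ℝ)⌉₊))
      atTop (nhds 0) :=
    Real.tendsto_exp_atBot.comp ((tendsto_natCast_atTop_atTop.comp hv).const_mul_atTop_of_neg
      (by linarith))
  have herr := (herr2.const_mul C).add herr1
  rw [mul_zero, add_zero] at herr
  filter_upwards [htail, herr.eventually (gt_mem_nhds (half_pos hε)),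
    hm.eventually_gt_atTop 0] with M h1 h2 h3 n c hδ hL hR x
  simp only [Function.comp_apply] at h2
  have ha : ∀ x, c.dTVC x ⌈(1 + η) * (M : ℝ)⌉₊ ≤ 8 * α := fun x => by
    have hx := c.dTVC_le_extremes (Nat.cast_nonneg ⌈(1 + η) * (M : ℝ)⌉₊) x
    linarith [c.dTVC_le_dTV_add hη 0 (Nat.le_ceil ((1 + η) * (M : ℝ))),
      c.dTVC_le_dTV_add hη (Fin.last n) (Nat.le_ceil ((1 + η) * (M : ℝ)))]
  have := c.dTV_add_le hδ0 hδ1 hδ h3 hη (Nat.le_ceil (η * (⌈(1 + η) * (M : ℝ)⌉₊ : ℝ))) ha x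
  linarith

end BDChain

section Families

variable {F : (n : ℕ) → BDChain n} {r s : ℕ → ℝ}

theorem cutoffWith_dTVMaxC (hr : ∀ n, 0 < r n) (hs : ∀ n, 0 < s n)
    (hL : cutoffWith (fun ε n => mixC ((F n).dTVC 0) ε) r)
    (hR : cutoffWith (fun ε n => mixC ((F n).dTVC (Fin.last n)) ε) s) :
    cutoffWith (fun ε n => mixC ((F n).dTVMaxC) ε) fun n => max (r n) (s n) := by
  have hsmall : ∀ ε ∈ Set.Ioo (0 : ℝ) 1, ∀ η > 0, ∀ᶠ n in atTop,
      0 ≤ (1 + η) * max (r n) (s n) ∧ (F n).dTVMaxC ((1 + η) * max (r n) (s n)) ≤ ε := by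
    intro ε hε η hη
    have hε' : ε / 4 ∈ Set.Ioo (0 : ℝ) 1 := ⟨by linarith [hε.1], by linarith [hε.2]⟩
    filter_upwards [hL.eventually_le_of_mixC (fun n => (F n).dTVC_antitoneOn 0) hr hε' hη,
      hR.eventually_le_of_mixC (fun n => (F n).dTVC_antitoneOn (Fin.last n)) hs hε' hη]
      with n h1 h2
    have h0 : 0 ≤ (1 + η) * max (r n) (s n) :=
      mul_nonneg (by linarith) (le_max_of_le_left (hr n).le)
    refine ⟨h0, ciSup_le fun x => ((F n).dTVC_le_extremes h0 x).trans ?_⟩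
    have h3 := h1 ((1 + η) * max (r n) (s n)) (by gcongr; exact le_max_left _ _)
    have h4 := h2 ((1 + η) * max (r n) (s n)) (by gcongr; exact le_max_right _ _)
    linarith
  refine cutoffWith_max hr hs hL hR (fun ε hε => ?_) fun ε hε η hη => ?_
  · filter_upwards [hsmall ε hε 1 one_pos] with n hn
    refine ⟨csInf_le_csInf (bddBelow_mixC_set _ _) ⟨_, hn⟩ fun u hu => ⟨hu.1, ?_⟩,
      csInf_le_csInf (bddBelow_mixC_set _ _) ⟨_, hn⟩ fun u hu => ⟨hu.1, ?_⟩⟩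
    · exact ((F n).dTVC_le_dTVMaxC _ u).trans hu.2
    · exact ((F n).dTVC_le_dTVMaxC _ u).trans hu.2
  · filter_upwards [hsmall ε hε η hη] with n hn
    exact csInf_le (bddBelow_mixC_set _ _) hn

/-- Cutoff times of lazy chains started at one end point diverge. -/
lemma tendsto_cutoff_time_atTop {δ : ℝ} (hδ0 : 0 < δ) (hδ1 : δ < 1)
    (hδ : ∀ n, ∀ i : Fin (n + 1), δ ≤ (F n).K i i) (hr : ∀ n, 0 < r n)
    (hL : cutoffWith (fun ε n => ((mixD ((F n).dTV 0) ε : ℕ) : ℝ)) r) :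
    Tendsto r atTop atTop := by
  refine tendsto_atTop.2 fun b => ?_
  set N := ⌈2 * b⌉₊
  have hN0 : 0 < δ ^ N / 2 := by positivity
  have hN1 : δ ^ N / 2 < 1 := by linarith [pow_le_one₀ hδ0.le hδ1.le (n := N)]
  have hε₁ : 1 - δ ^ N / 2 ∈ Set.Ioo (0 : ℝ) 1 := ⟨by linarith, by linarith⟩
  filter_upwards [hL.eventually_pos hr hε₁, hL.eventually_pos hr ⟨hN0, hN1⟩,
    hL.eventually_bounds hr ⟨hN0, hN1⟩ one_pos] with n h1 h2 h3
  have hπ : (F n).pi 0 < δ ^ N / 2 := by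
    by_contra hcon
    have : mixD ((F n).dTV 0) (1 - δ ^ N / 2) ≤ 0 :=
      Nat.sInf_le (((F n).dTV_zero_le 0).trans (by linarith))
    have h1' : 0 < mixD ((F n).dTV 0) (1 - δ ^ N / 2) := by exact_mod_cast h1
    omega
  have hNT : N ≤ mixD ((F n).dTV 0) (δ ^ N / 2) := by
    by_contra hcon
    have h4 := le_of_mixD_le ((F n).dTV_antitone 0) (by exact_mod_cast h2) (not_le.1 hcon).le
    linarith [(F n).pow_apply_sub_pi_le_dTV 0 N, (F n).pow_le_pow_apply_self hδ0.le (hδ n) 0 N]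
  have h5 : (N : ℝ) ≤ mixD ((F n).dTV 0) (δ ^ N / 2) := by exact_mod_cast hNT
  linarith [Nat.le_ceil (2 * b), h3.2]

theorem cutoffWith_dTVMax (hr : ∀ n, 0 < r n) (hs : ∀ n, 0 < s n)
    (hlazy : ∃ δ > (0 : ℝ), ∀ n, ∀ i : Fin (n + 1), δ ≤ (F n).K i i)
    (hL : cutoffWith (fun ε n => ((mixD ((F n).dTV 0) ε : ℕ) : ℝ)) r)
    (hR : cutoffWith (fun ε n => ((mixD ((F n).dTV (Fin.last n)) ε : ℕ) : ℝ)) s) :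
    cutoffWith (fun ε n => ((mixD ((F n).dTVMax) ε : ℕ) : ℝ)) fun n => max (r n) (s n) := by
  obtain ⟨δ, hδ0, hδ1, hδ⟩ : ∃ δ > (0 : ℝ), δ < 1 ∧ ∀ n, ∀ i : Fin (n + 1), δ ≤ (F n).K i i := by
    obtain ⟨δ, hδ0, hδ⟩ := hlazy
    exact ⟨min δ (1 / 2), by positivity, (min_le_right _ _).trans_lt one_half_lt_one,
      fun n i => (min_le_left _ _).trans (hδ n i)⟩
  have ht : Tendsto (fun n => max (r n) (s n)) atTop atTop :=
    tendsto_atTop_mono (fun n => le_max_left _ _) (tendsto_cutoff_time_atTop hδ0 hδ1 hδ hr hL)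
  have hsmall : ∀ ε ∈ Set.Ioo (0 : ℝ) 1, ∀ η > 0, ∀ᶠ n in atTop, ∃ N : ℕ,
      (N : ℝ) ≤ (1 + η) * max (r n) (s n) ∧ (F n).dTVMax N ≤ ε := by
    intro ε hε η' hη'
    set η := min (η' / 8) 1
    have hη : 0 < η := by positivity
    have hη1 : η ≤ 1 := min_le_right _ _
    have hη8 : 8 * η ≤ η' := by linarith [min_le_left (η' / 8) 1]
    obtain ⟨α, hα, hM⟩ := BDChain.exists_dTV_le_of_dTV_extremes_le hδ0 hδ1 hε.1 hη
    have hMt : Tendsto (fun n => ⌈(1 + η) * max (r n) (s n)⌉₊) atTop atTop :=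
      tendsto_nat_ceil_atTop.comp (ht.const_mul_atTop (show 0 < 1 + η by linarith))
    filter_upwards [hMt.eventually hM, hL.eventually_bounds hr hα hη, hL.eventually_pos hr hα,
      hR.eventually_bounds hs hα hη, hR.eventually_pos hs hα,
      ht.eventually_ge_atTop (7 / η)] with n h1 h2 h3 h4 h5 h6
    set t := max (r n) (s n)
    set M := ⌈(1 + η) * t⌉₊
    set m := ⌈(1 + η) * (M : ℝ)⌉₊
    set v := ⌈η * (m : ℝ)⌉₊
    have hMle : (1 + η) * t ≤ M := Nat.le_ceil _
    have hrt : (1 + η) * r n ≤ (1 + η) * t := by gcongr; exact le_max_left _ _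
    have hst : (1 + η) * s n ≤ (1 + η) * t := by gcongr; exact le_max_right _ _
    have hLM : (F n).dTV 0 M ≤ α := by
      refine le_of_mixD_le ((F n).dTV_antitone 0) (by exact_mod_cast h3) ?_
      have : ((mixD ((F n).dTV 0) α : ℕ) : ℝ) ≤ M := by linarith [h2.2]
      exact_mod_cast this
    have hRM : (F n).dTV (Fin.last n) M ≤ α := by
      refine le_of_mixD_le ((F n).dTV_antitone _) (by exact_mod_cast h5) ?_
      have : ((mixD ((F n).dTV (Fin.last n)) α : ℕ) : ℝ) ≤ M := by linarith [h4.2]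
      exact_mod_cast this
    refine ⟨m + v, ?_, ciSup_le (h1 n (F n) (hδ n) hLM hRM)⟩
    have ht0 : 0 < t := lt_max_of_lt_left (hr n)
    have hM1 : (M : ℝ) < (1 + η) * t + 1 := Nat.ceil_lt_add_one (by positivity)
    have hm1 : (m : ℝ) < (1 + η) * M + 1 := Nat.ceil_lt_add_one (by positivity)
    have hm2 : (m : ℝ) ≤ (1 + η) * ((1 + η) * t + 1) + 1 := hm1.le.trans (by gcongr)
    have hv1 : (v : ℝ) < η * m + 1 := Nat.ceil_lt_add_one (by positivity)
    have h7 : 7 ≤ t * η := (div_le_iff₀ hη).1 h6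
    push_cast
    calc (m : ℝ) + v ≤ (1 + η) * m + 1 := by linarith
      _ ≤ (1 + η) * ((1 + η) * ((1 + η) * t + 1) + 1) + 1 := by gcongr
      _ = t + η * (3 + 3 * η + η * η) * t + (3 + 3 * η + η * η) := by ring
      _ ≤ t + η * 7 * t + 7 := by gcongr <;> nlinarith
      _ ≤ (1 + 8 * η) * t := by linarith
      _ ≤ (1 + η') * t := by gcongr
  refine cutoffWith_max hr hs hL hR (fun ε hε => ?_) fun ε hε η hη => ?_
  · filter_upwards [hsmall ε hε 1 one_pos] with n hn
    obtain ⟨N, -, hN⟩ := hn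
    have hmem : (F n).dTVMax (mixD ((F n).dTVMax) ε) ≤ ε :=
      Nat.sInf_mem (s := {m | (F n).dTVMax m ≤ ε}) ⟨N, hN⟩
    constructor
    · exact_mod_cast Nat.sInf_le (((F n).dTV_le_dTVMax _ _).trans hmem)
    · exact_mod_cast Nat.sInf_le (((F n).dTV_le_dTVMax _ _).trans hmem)
  · filter_upwards [hsmall ε hε η hη] with n hn
    obtain ⟨N, hNle, hN⟩ := hn
    refine le_trans ?_ hNle
    exact_mod_cast Nat.sInf_le hN

end Families

/-- Theorem `t-tv5`(1).  If the left- and right-boundary families have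
total variation cutoffs with cutoff times `r_n` and `s_n`, then the family has a maximum
total variation cutoff with cutoff time `max{r_n, s_n}`; in continuous time
unconditionally, and in discrete time under `inf_{n,i} K_n(i,i) > 0`. -/
theorem birth_death_boundary_cutoffs_give_max_cutoff
    (F : (n : ℕ) → BDChain n) (r s : ℕ → ℝ)
    (hr : ∀ n, 0 < r n) (hs : ∀ n, 0 < s n) :
    -- continuous time
    ((cutoffWith (fun ε n => mixC ((F n).dTVC 0) ε) r →
      cutoffWith (fun ε n => mixC ((F n).dTVC (Fin.last n)) ε) s →
      cutoffWith (fun ε n => mixC ((F n).dTVMaxC) ε) (fun n => max (r n) (s n))) ∧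
    -- discrete time
    ((∃ δ > (0 : ℝ), ∀ n, ∀ i : Fin (n + 1), δ ≤ (F n).K i i) →
      cutoffWith (fun ε n => ((mixD ((F n).dTV 0) ε : ℕ) : ℝ)) r →
      cutoffWith (fun ε n => ((mixD ((F n).dTV (Fin.last n)) ε : ℕ) : ℝ)) s →
      cutoffWith (fun ε n => ((mixD ((F n).dTVMax) ε : ℕ) : ℝ))
        (fun n => max (r n) (s n)))) :=
  ⟨cutoffWith_dTVMaxC hr hs, cutoffWith_dTVMax hr hs⟩

end
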